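/- arXiv:2511.16300 — 4 statements merged into one kernel-verified Lean document; each statement's English description precedes it below -/
import Mathlib

section
/- Assume (A1)–(A3) hold and bc − ad > 0, and let s* > 0 be the critical speed from Proposition 1.2 with strictly increasing semi-wave solutions (φ_s, ψ_s) for s ∈ [0,s*). Then (φ_s, ψ_s) → (0,0) in C²_loc([0,+∞)) as s → (s*)⁻; that is, for every compact set K ⊂ [0,+∞), sup_K (|φ_s| + |φ'_s| + |φ''_s|) → 0 and sup_K (|ψ_s| + |ψ'_s| + |ψ''_s|) → 0 as s increases to s*. -/
open Set Filter Topology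

noncomputable section

/-- First spatial derivative. -/
def pdx (w : ℝ → ℝ → ℝ) (x t : ℝ) : ℝ := deriv (fun y => w y t) x

/-- Second spatial derivative. -/
def pdxx (w : ℝ → ℝ → ℝ) (x t : ℝ) : ℝ := deriv (fun y => pdx w y t) x

/-- Time derivative. -/
def pdt (w : ℝ → ℝ → ℝ) (x t : ℝ) : ℝ := deriv (fun s => w x s) t

/-- Left-sided spatial derivative (used at the right free boundary). -/
def pdxL (w : ℝ → ℝ → ℝ) (x t : ℝ) : ℝ := derivWithin (fun y => w y t) (Iic x) x

/-- Right-sided spatial derivative (used at the left free boundary). -/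
def pdxR (w : ℝ → ℝ → ℝ) (x t : ℝ) : ℝ := derivWithin (fun y => w y t) (Ici x) x

/-- Conditions (A1)-(A3) on the loss functions F and G. -/
structure CondA (F G : ℝ → ℝ) : Prop where
  regF : ContDiffOn ℝ 2 F (Ici 0)
  regG : ContDiffOn ℝ 2 G (Ici 0)
  monoF : MonotoneOn F (Ici 0)
  monoG : MonotoneOn G (Ici 0)
  zeroF : F 0 = 0
  zeroG : G 0 = 0
  dzeroF : derivWithin F (Ici 0) 0 = 0
  dzeroG : derivWithin G (Ici 0) 0 = 0
  ratioF : StrictMonoOn (fun z => F z / z) (Ioi 0)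
  ratioG : StrictMonoOn (fun z => G z / z) (Ioi 0)
  infF : Tendsto (fun z => F z / z) atTop atTop
  infG : Tendsto (fun z => G z / z) atTop atTop

/-- Condition (1.3) on the initial data. -/
structure InitData (h0 : ℝ) (u0 v0 : ℝ → ℝ) : Prop where
  regU : ContDiffOn ℝ 2 u0 (Icc (-h0) h0)
  regV : ContDiffOn ℝ 2 v0 (Icc (-h0) h0)
  uL : u0 (-h0) = 0
  uR : u0 h0 = 0
  vL : v0 (-h0) = 0
  vR : v0 h0 = 0
  uPos : ∀ x ∈ Ioo (-h0) h0, 0 < u0 x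
  vPos : ∀ x ∈ Ioo (-h0) h0, 0 < v0 x

/-- (u,v,g,h) is a classical solution of the free boundary problem (1.2). -/
structure IsSol (d1 d2 a b c d μ ρ h0 : ℝ) (F G u0 v0 : ℝ → ℝ)
    (u v : ℝ → ℝ → ℝ) (g h : ℝ → ℝ) : Prop where
  gltH : ∀ t ≥ (0:ℝ), g t < h t
  contU : ContinuousOn (fun p : ℝ × ℝ => u p.1 p.2)
    {p : ℝ × ℝ | 0 ≤ p.2 ∧ p.1 ∈ Icc (g p.2) (h p.2)}
  contV : ContinuousOn (fun p : ℝ × ℝ => v p.1 p.2)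
    {p : ℝ × ℝ | 0 ≤ p.2 ∧ p.1 ∈ Icc (g p.2) (h p.2)}
  diffG : ∀ t > (0:ℝ), DifferentiableAt ℝ g t
  diffH : ∀ t > (0:ℝ), DifferentiableAt ℝ h t
  regU : ∀ t > (0:ℝ), ∀ x ∈ Ioo (g t) (h t),
    DifferentiableAt ℝ (fun y => u y t) x ∧ DifferentiableAt ℝ (fun y => pdx u y t) x ∧
      DifferentiableAt ℝ (fun s => u x s) t
  regV : ∀ t > (0:ℝ), ∀ x ∈ Ioo (g t) (h t),
    DifferentiableAt ℝ (fun y => v y t) x ∧ DifferentiableAt ℝ (fun y => pdx v y t) x ∧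
      DifferentiableAt ℝ (fun s => v x s) t
  pdeU : ∀ t > (0:ℝ), ∀ x ∈ Ioo (g t) (h t),
    pdt u x t - d1 * pdxx u x t = -a * u x t + b * v x t - F (u x t)
  pdeV : ∀ t > (0:ℝ), ∀ x ∈ Ioo (g t) (h t),
    pdt v x t - d2 * pdxx v x t = c * u x t - d * v x t - G (v x t)
  bcUL : ∀ t > (0:ℝ), u (g t) t = 0
  bcUR : ∀ t > (0:ℝ), u (h t) t = 0
  bcVL : ∀ t > (0:ℝ), v (g t) t = 0
  bcVR : ∀ t > (0:ℝ), v (h t) t = 0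
  stefanH : ∀ t > (0:ℝ), deriv h t = -μ * (pdxL v (h t) t + ρ * pdxL u (h t) t)
  stefanG : ∀ t > (0:ℝ), deriv g t = -μ * (pdxR v (g t) t + ρ * pdxR u (g t) t)
  initG : g 0 = -h0
  initH : h 0 = h0
  initU : ∀ x ∈ Icc (-h0) h0, u x 0 = u0 x
  initV : ∀ x ∈ Icc (-h0) h0, v x 0 = v0 x

/-- Membership of a function of (x,t), on the moving domain determined by g and h,
in the parabolic Hölder space `C^{2+α,1+α/2}`. -/
def ParabolicHolder (α : ℝ) (w : ℝ → ℝ → ℝ) (g h : ℝ → ℝ) : Prop :=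
  (∀ t > (0:ℝ), ∀ x ∈ Ioo (g t) (h t),
    DifferentiableAt ℝ (fun y => w y t) x ∧ DifferentiableAt ℝ (fun y => pdx w y t) x ∧
      DifferentiableAt ℝ (fun s => w x s) t) ∧
  ∃ M > (0:ℝ), ∀ t > (0:ℝ), ∀ s > (0:ℝ), ∀ x ∈ Ioo (g t) (h t), ∀ y ∈ Ioo (g s) (h s),
    |w x t - w y s| ≤ M * (|x - y| + |t - s| ^ ((1:ℝ)/2)) ∧
    |pdx w x t - pdx w y s| ≤ M * (|x - y| ^ α + |t - s| ^ ((1+α)/2)) ∧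
    |pdxx w x t - pdxx w y s| ≤ M * (|x - y| ^ α + |t - s| ^ (α/2)) ∧
    |pdt w x t - pdt w y s| ≤ M * (|x - y| ^ α + |t - s| ^ (α/2))

/-- Membership of a one-variable function in `C^{1+β}((0,∞))`. -/
def COneHolder (β : ℝ) (g : ℝ → ℝ) : Prop :=
  (∀ t > (0:ℝ), DifferentiableAt ℝ g t) ∧
  ∃ M > (0:ℝ), ∀ t > (0:ℝ), ∀ s > (0:ℝ), |deriv g t - deriv g s| ≤ M * |t - s| ^ β

/-- (ustar, vstar) is a positive equilibrium of the kinetic system. -/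
def IsEquilibrium (a b c d : ℝ) (F G : ℝ → ℝ) (ustar vstar : ℝ) : Prop :=
  0 < ustar ∧ 0 < vstar ∧
    -a * ustar + b * vstar - F ustar = 0 ∧ c * ustar - d * vstar - G vstar = 0

/-- (φ,ψ) is a solution of the semi-wave system (1.5) with speed s. -/
structure SemiWave (d1 d2 a b c d : ℝ) (F G : ℝ → ℝ) (ustar vstar s : ℝ)
    (φ ψ : ℝ → ℝ) : Prop where
  regφ : ContDiffOn ℝ 2 φ (Ici 0)
  regψ : ContDiffOn ℝ 2 ψ (Ici 0)
  odeφ : ∀ ξ > (0:ℝ),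
    d1 * deriv (deriv φ) ξ - s * deriv φ ξ - a * φ ξ + b * ψ ξ - F (φ ξ) = 0
  odeψ : ∀ ξ > (0:ℝ),
    d2 * deriv (deriv ψ) ξ - s * deriv ψ ξ + c * φ ξ - d * ψ ξ - G (ψ ξ) = 0
  zeroφ : φ 0 = 0
  zeroψ : ψ 0 = 0
  limφ : Tendsto φ atTop (𝓝 ustar)
  limψ : Tendsto ψ atTop (𝓝 vstar)

/-- (φ,ψ) is a strictly increasing solution of the semi-wave system (1.5) with speed s. -/
def IncSemiWave (d1 d2 a b c d : ℝ) (F G : ℝ → ℝ) (ustar vstar s : ℝ)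
    (φ ψ : ℝ → ℝ) : Prop :=
  SemiWave d1 d2 a b c d F G ustar vstar s φ ψ ∧
    StrictMonoOn φ (Ici 0) ∧ StrictMonoOn ψ (Ici 0)

/-- sstar is the critical speed s* of Proposition 1.2: for 0 ≤ s < s* the semi-wave
system has a unique strictly increasing solution, and none for s ≥ s*. -/
def IsCriticalSpeed (d1 d2 a b c d : ℝ) (F G : ℝ → ℝ) (ustar vstar sstar : ℝ) : Prop :=
  0 < sstar ∧
  (∀ s, 0 ≤ s → s < sstar →
    ∃ φ ψ, IncSemiWave d1 d2 a b c d F G ustar vstar s φ ψ ∧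
      ∀ φ' ψ', IncSemiWave d1 d2 a b c d F G ustar vstar s φ' ψ' →
        EqOn φ φ' (Ici 0) ∧ EqOn ψ ψ' (Ici 0)) ∧
  (∀ s, sstar ≤ s → ¬ ∃ φ ψ, IncSemiWave d1 d2 a b c d F G ustar vstar s φ ψ)

/-- s is the speed s_{μ,ρ}: the unique s ∈ (0,s*) for which the semi-wave with speed s
satisfies the free boundary compatibility condition (s mu). -/
def IsSpeedMuRho (d1 d2 a b c d μ ρ : ℝ) (F G : ℝ → ℝ) (ustar vstar sstar s : ℝ) : Prop :=
  s ∈ Ioo 0 sstar ∧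
  ∃ φ ψ, IncSemiWave d1 d2 a b c d F G ustar vstar s φ ψ ∧
    μ * (derivWithin ψ (Ici 0) 0 + ρ * derivWithin φ (Ici 0) 0) = s

/-- `f` has derivative `f'` on the half line. -/
def HD (f f' : ℝ → ℝ) : Prop := ∀ x, 0 ≤ x → HasDerivWithinAt f (f' x) (Ici 0) x

lemma HD.cont {f f' : ℝ → ℝ} (h : HD f f') : ContinuousOn f (Ici 0) :=
  fun x hx => (h x hx).continuousWithinAt

lemma HD.at {f f' : ℝ → ℝ} (h : HD f f') {x : ℝ} (hx : 0 < x) : HasDerivAt f (f' x) x :=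
  (h x hx.le).hasDerivAt (Ici_mem_nhds hx)

lemma HD.mono {f f' : ℝ → ℝ} (h : HD f f') (h0 : ∀ x, 0 ≤ x → 0 ≤ f' x) :
    MonotoneOn f (Ici 0) := by
  refine monotoneOn_of_hasDerivWithinAt_nonneg (f' := f') (convex_Ici 0) h.cont ?_ ?_
  · intro x hx
    rw [interior_Ici] at hx
    exact (h.at hx).hasDerivWithinAt
  · intro x hx
    rw [interior_Ici] at hx
    exact h0 x (le_of_lt hx)

lemma HD.small {φ p q : ℝ → ℝ} (h1 : HD φ p) (h2 : HD p q) {K : ℝ}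
    (hq : ∀ x, 0 ≤ x → -K ≤ q x) (hK : 0 ≤ K) {x h : ℝ} (hx : 0 ≤ x) (hh : 0 < h) :
    p x ≤ (φ (x + h) - φ x) / h + K * h := by
  obtain ⟨y, hy, hy2⟩ := exists_hasDerivAt_eq_slope φ p (show x < x + h by linarith)
    (h1.cont.mono fun z hz => le_trans hx hz.1)
    (fun z hz => h1.at (lt_of_le_of_lt hx hz.1))
  have hm : MonotoneOn (fun z => p z + K * z) (Ici 0) := by
    refine HD.mono (f' := fun z => q z + K * 1) ?_ ?_
    · intro z hz
      exact (h2 z hz).add ((hasDerivWithinAt_id z _).const_mul K)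
    · intro z hz
      have := hq z hz
      simp only [mul_one]; linarith
  have h3 := hm (show x ∈ Ici 0 from hx) (show y ∈ Ici 0 from le_trans hx hy.1.le) hy.1.le
  simp only at h3
  have h4 : K * y ≤ K * (x + h) := mul_le_mul_of_nonneg_left hy.2.le hK
  rw [hy2] at h3
  have e : x + h - x = h := by ring
  rw [e] at h3
  linarith

lemma HD.lip {f f' : ℝ → ℝ} (h : HD f f') {M : ℝ} (hM : ∀ x, 0 ≤ x → |f' x| ≤ M) {x y : ℝ}
    (hx : 0 ≤ x) (hy : 0 ≤ y) : |f y - f x| ≤ M * |y - x| :=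
  (convex_Ici (0:ℝ)).norm_image_sub_le_of_norm_hasDerivWithin_le (fun z hz => h z hz)
    (fun z hz => hM z hz) hx hy

lemma HD.quad {f f' : ℝ → ℝ} (h : HD f f') {M : ℝ} (hM0 : 0 ≤ M)
    (hM : ∀ x y, 0 ≤ x → 0 ≤ y → |f' y - f' x| ≤ M * |y - x|) {x y : ℝ}
    (hx : 0 ≤ x) (hy : 0 ≤ y) : |f y - f x - (y - x) * f' x| ≤ M * |y - x| * |y - x| := by
  have hs : uIcc x y ⊆ Ici (0:ℝ) := by
    intro z hz
    rw [mem_uIcc] at hz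
    rcases hz with hz | hz
    · exact le_trans hx hz.1
    · exact le_trans hy hz.1
  have := (convex_uIcc x y).norm_image_sub_le_of_norm_hasDerivWithin_le
    (f := fun z => f z - z * f' x) (f' := fun z => f' z - 1 * f' x) (C := M * |y - x|)
    (x := x) (y := y)
    (fun z hz => ((h z (hs hz)).mono hs).sub ((hasDerivWithinAt_id z _).mul_const _))
    (fun z hz => by
      rw [one_mul]
      refine (hM x z hx (hs hz)).trans ?_
      exact mul_le_mul_of_nonneg_left (abs_sub_left_of_mem_uIcc hz) hM0)
    left_mem_uIcc right_mem_uIcc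
  rw [Real.norm_eq_abs, Real.norm_eq_abs] at this
  convert this using 2
  ring

lemma HD.of_quad {f f' : ℝ → ℝ} {M : ℝ}
    (h : ∀ x y, 0 ≤ x → 0 ≤ y → |f y - f x - (y - x) * f' x| ≤ M * |y - x| * |y - x|) :
    HD f f' := by
  intro x hx
  rw [hasDerivWithinAt_iff_isLittleO]
  have h1 : (fun y => f y - f x - (y - x) • f' x) =O[𝓝[Ici 0] x] fun y => (y - x) * (y - x) := by
    refine Asymptotics.IsBigO.of_bound M ?_
    filter_upwards [self_mem_nhdsWithin] with y hy
    have := h x y hx hy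
    rw [smul_eq_mul, Real.norm_eq_abs, Real.norm_eq_abs, abs_mul]
    linarith
  refine h1.trans_isLittleO ?_
  have h2 : (fun y : ℝ => y - x) =o[𝓝[Ici 0] x] fun _ => (1:ℝ) := by
    rw [Asymptotics.isLittleO_one_iff]
    have : Tendsto (fun y : ℝ => y - x) (𝓝 x) (𝓝 (x - x)) := by
      exact (continuous_id.sub continuous_const).tendsto x
    rw [sub_self] at this
    exact this.mono_left nhdsWithin_le_nhds
  have h3 := h2.mul_isBigO (Asymptotics.isBigO_refl (fun y : ℝ => y - x) (𝓝[Ici 0] x))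
  simpa using h3

lemma HD.limit {U : Filter ℝ} [U.NeBot] {f f' : ℝ → ℝ → ℝ} {g g' : ℝ → ℝ} {M : ℝ}
    (hM0 : 0 ≤ M) (h : ∀ᶠ s in U, HD (f s) (f' s))
    (hM : ∀ᶠ s in U, ∀ x y, 0 ≤ x → 0 ≤ y → |f' s y - f' s x| ≤ M * |y - x|)
    (hf : ∀ x, 0 ≤ x → Tendsto (fun s => f s x) U (𝓝 (g x)))
    (hf' : ∀ x, 0 ≤ x → Tendsto (fun s => f' s x) U (𝓝 (g' x))) : HD g g' := by
  refine HD.of_quad (M := M) ?_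
  intro x y hx hy
  refine le_of_tendsto ((((hf y hy).sub (hf x hx)).sub ((hf' x hx).const_mul (y - x))).abs) ?_
  filter_upwards [h, hM] with s h1 h2
  exact h1.quad hM0 h2 hx hy

lemma lip_of_C2 {F : ℝ → ℝ} (hF : ContDiffOn ℝ 2 F (Ici 0)) (M : ℝ) :
    ∃ L, 0 ≤ L ∧ ∀ x ∈ Icc 0 M, ∀ y ∈ Icc 0 M, |F y - F x| ≤ L * |y - x| := by
  have hc : ContinuousOn (derivWithin F (Ici 0)) (Ici 0) :=
    hF.continuousOn_derivWithin (uniqueDiffOn_Ici 0) (by norm_num)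
  have hs : Icc 0 M ⊆ Ici (0:ℝ) := fun z hz => hz.1
  obtain ⟨L, hL⟩ := isCompact_Icc.exists_bound_of_continuousOn (hc.mono hs)
  refine ⟨max L 0, le_max_right _ _, fun x hx y hy => ?_⟩
  exact (convex_Icc (0:ℝ) M).norm_image_sub_le_of_norm_hasDerivWithin_le
    (fun z hz => (((hF.differentiableOn (by norm_num)) z (hs hz)).hasDerivWithinAt).mono hs)
    (fun z hz => (hL z hz).trans (le_max_left _ _)) hx hy

/-- Classical bounded monotone solutions of the system on the half line. -/
structure WV (d1 d2 a b c d : ℝ) (F G : ℝ → ℝ) (us vs s : ℝ)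
    (φ p q ψ r t : ℝ → ℝ) : Prop where
  hφ : HD φ p
  hp : HD p q
  hψ : HD ψ r
  hr : HD r t
  e1 : ∀ x, 0 ≤ x → d1 * q x - s * p x - a * φ x + b * ψ x - F (φ x) = 0
  e2 : ∀ x, 0 ≤ x → d2 * t x - s * r x - d * ψ x + c * φ x - G (ψ x) = 0
  z1 : φ 0 = 0
  z2 : ψ 0 = 0
  b1 : ∀ x, 0 ≤ x → φ x ∈ Icc 0 us
  b2 : ∀ x, 0 ≤ x → ψ x ∈ Icc 0 vs
  m1 : MonotoneOn φ (Ici 0)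
  m2 : MonotoneOn ψ (Ici 0)
  p0 : ∀ x, 0 ≤ x → 0 ≤ p x
  r0 : ∀ x, 0 ≤ x → 0 ≤ r x

lemma WV.symm {d1 d2 a b c d : ℝ} {F G : ℝ → ℝ} {us vs s : ℝ}
    {φ p q ψ r t : ℝ → ℝ} (h : WV d1 d2 a b c d F G us vs s φ p q ψ r t) :
    WV d2 d1 d c b a G F vs us s ψ r t φ p q :=
  ⟨h.hψ, h.hr, h.hφ, h.hp, h.e2, h.e1, h.z2, h.z1, h.b2, h.b1, h.m2, h.m1, h.r0, h.p0⟩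

lemma CondA.symm {F G : ℝ → ℝ} (h : CondA F G) : CondA G F :=
  ⟨h.regG, h.regF, h.monoG, h.monoF, h.zeroG, h.zeroF, h.dzeroG, h.dzeroF, h.ratioG, h.ratioF,
    h.infG, h.infF⟩

lemma wave_comp {φ : ℝ → ℝ} (hφ : ContDiffOn ℝ 2 φ (Ici 0)) :
    HD φ (derivWithin φ (Ici 0)) ∧
    HD (derivWithin φ (Ici 0)) (derivWithin (derivWithin φ (Ici 0)) (Ici 0)) ∧
    ContinuousOn (derivWithin (derivWithin φ (Ici 0)) (Ici 0)) (Ici 0) ∧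
    (∀ x, 0 < x → deriv φ x = derivWithin φ (Ici 0) x) ∧
    (∀ x, 0 < x → deriv (deriv φ) x = derivWithin (derivWithin φ (Ici 0)) (Ici 0) x) := by
  have h1 : ContDiffOn ℝ 1 (derivWithin φ (Ici 0)) (Ici 0) :=
    hφ.derivWithin (uniqueDiffOn_Ici 0) (by norm_num)
  have h2 : ContinuousOn (derivWithin (derivWithin φ (Ici 0)) (Ici 0)) (Ici 0) :=
    h1.continuousOn_derivWithin (uniqueDiffOn_Ici 0) (by norm_num)
  have h3 : ∀ x, 0 < x → deriv φ x = derivWithin φ (Ici 0) x := fun x hx =>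
    (derivWithin_of_mem_nhds (Ici_mem_nhds hx)).symm
  refine ⟨fun x hx => ((hφ.differentiableOn (by norm_num)) x hx).hasDerivWithinAt,
    fun x hx => ((h1.differentiableOn (by norm_num)) x hx).hasDerivWithinAt, h2, h3, ?_⟩
  intro x hx
  rw [derivWithin_of_mem_nhds (Ici_mem_nhds hx)]
  apply Filter.EventuallyEq.deriv_eq
  filter_upwards [Ioi_mem_nhds hx] with y hy using h3 y hy

lemma extend_zero {g : ℝ → ℝ} (hg : ContinuousOn g (Ici 0)) (h : ∀ x, 0 < x → g x = 0) :
    ∀ x, 0 ≤ x → g x = 0 := by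
  intro x hx
  rcases hx.eq_or_lt with rfl | hx
  · have h1 : Tendsto g (𝓝[>] 0) (𝓝 (g 0)) :=
      (hg 0 self_mem_Ici).mono_left (nhdsWithin_mono _ Ioi_subset_Ici_self)
    have h2 : Tendsto g (𝓝[>] 0) (𝓝 0) := by
      refine tendsto_const_nhds.congr' ?_
      filter_upwards [self_mem_nhdsWithin] with y hy using (h y hy).symm
    exact tendsto_nhds_unique h1 h2
  · exact h x hx

lemma mono_le_lim {φ : ℝ → ℝ} {u : ℝ} (h : MonotoneOn φ (Ici 0)) (hl : Tendsto φ atTop (𝓝 u))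
    {x : ℝ} (hx : 0 ≤ x) : φ x ≤ u := by
  refine ge_of_tendsto hl ?_
  filter_upwards [eventually_ge_atTop x] with y hy
  exact h (show x ∈ Ici 0 from hx) (show y ∈ Ici 0 from hx.trans hy) hy

lemma WV.of_wave {d1 d2 a b c d : ℝ} {F G : ℝ → ℝ} (hA : CondA F G) {us vs s : ℝ}
    {φ ψ : ℝ → ℝ} (h : IncSemiWave d1 d2 a b c d F G us vs s φ ψ) :
    WV d1 d2 a b c d F G us vs s φ (derivWithin φ (Ici 0))
      (derivWithin (derivWithin φ (Ici 0)) (Ici 0)) ψ (derivWithin ψ (Ici 0))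
      (derivWithin (derivWithin ψ (Ici 0)) (Ici 0)) := by
  obtain ⟨hw, hm1, hm2⟩ := h
  obtain ⟨a1, a2, a3, a4, a5⟩ := wave_comp hw.regφ
  obtain ⟨b1, b2, b3, b4, b5⟩ := wave_comp hw.regψ
  have c1 : ∀ x, 0 ≤ x → φ x ∈ Icc 0 us := fun x hx =>
    ⟨hw.zeroφ ▸ hm1.monotoneOn self_mem_Ici (show x ∈ Ici 0 from hx) hx,
      mono_le_lim hm1.monotoneOn hw.limφ hx⟩
  have c2 : ∀ x, 0 ≤ x → ψ x ∈ Icc 0 vs := fun x hx =>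
    ⟨hw.zeroψ ▸ hm2.monotoneOn self_mem_Ici (show x ∈ Ici 0 from hx) hx,
      mono_le_lim hm2.monotoneOn hw.limψ hx⟩
  have f1 : ContinuousOn (fun x => F (φ x)) (Ici 0) :=
    hA.regF.continuousOn.comp a1.cont fun x hx => (c1 x hx).1
  have f2 : ContinuousOn (fun x => G (ψ x)) (Ici 0) :=
    hA.regG.continuousOn.comp b1.cont fun x hx => (c2 x hx).1
  have k1 := a1.cont
  have k2 := a2.cont
  have k3 := b1.cont
  have k4 := b2.cont
  refine ⟨a1, a2, b1, b2, ?_, ?_, hw.zeroφ, hw.zeroψ, c1, c2, hm1.monotoneOn, hm2.monotoneOn,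
    fun x hx => hm1.monotoneOn.derivWithin_nonneg, fun x hx => hm2.monotoneOn.derivWithin_nonneg⟩
  · apply extend_zero
    · exact ((((continuousOn_const.mul a3).sub (continuousOn_const.mul k2)).sub
        (continuousOn_const.mul k1)).add (continuousOn_const.mul k3)).sub f1
    · intro x hx
      rw [← a5 x hx, ← a4 x hx]
      exact hw.odeφ x hx
  · apply extend_zero
    · exact ((((continuousOn_const.mul b3).sub (continuousOn_const.mul k4)).sub
        (continuousOn_const.mul k3)).add (continuousOn_const.mul k1)).sub f2
    · intro x hx
      rw [← b5 x hx, ← b4 x hx]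
      linarith [hw.odeψ x hx]

lemma abs_le_div_of {D X Y : ℝ} (hD : 0 < D) (h : D * X ≤ Y) (h' : -Y ≤ D * X) :
    |X| ≤ Y / D := by
  rw [le_div_iff₀ hD, abs_le.2 ⟨h', h⟩ |> fun h => (show |X| * D = |D * X| by
    rw [abs_mul, abs_of_pos hD, mul_comm])]
  exact abs_le.2 ⟨h', h⟩

lemma bounds1 {d1 : ℝ} (d2 : ℝ) {a b : ℝ} (c d : ℝ) {F G : ℝ → ℝ} (hA : CondA F G) (us vs S : ℝ)
    (hd1 : 0 < d1) (ha : 0 < a) (hb : 0 < b) (hus : 0 < us) (hvs : 0 < vs) (hS : 0 ≤ S) :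
    ∃ M, 0 ≤ M ∧ ∀ s, 0 ≤ s → s ≤ S → ∀ φ p q ψ r t,
      WV d1 d2 a b c d F G us vs s φ p q ψ r t →
      ∀ x, 0 ≤ x → p x ≤ M ∧ |q x| ≤ M := by
  have hF0 : 0 ≤ F us := hA.zeroF ▸ hA.monoF self_mem_Ici (show us ∈ Ici 0 from hus.le) hus.le
  obtain ⟨K, hK⟩ : ∃ K, K = a * us + b * vs + F us := ⟨_, rfl⟩
  have hK0 : 0 ≤ K := by rw [hK]; positivity
  obtain ⟨P, hP⟩ : ∃ P, P = us + K / d1 := ⟨_, rfl⟩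
  have hP0 : 0 ≤ P := by rw [hP]; positivity
  refine ⟨max P ((S * P + K) / d1), le_max_of_le_left hP0, ?_⟩
  intro s hs hsS φ p q ψ r t h
  have hg : ∀ x, 0 ≤ x → |a * φ x - b * ψ x + F (φ x)| ≤ K := by
    intro x hx
    have h1 := h.b1 x hx
    have h2 := h.b2 x hx
    have h3 : 0 ≤ F (φ x) :=
      hA.zeroF ▸ hA.monoF self_mem_Ici (show φ x ∈ Ici 0 from h1.1) h1.1
    have h4 : F (φ x) ≤ F us :=
      hA.monoF (show φ x ∈ Ici 0 from h1.1) (show us ∈ Ici 0 from hus.le) h1.2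
    have h5 := mul_le_mul_of_nonneg_left h1.2 ha.le
    have h6 := mul_le_mul_of_nonneg_left h2.2 hb.le
    have h7 := mul_nonneg ha.le h1.1
    have h8 := mul_nonneg hb.le h2.1
    have h9 := mul_nonneg ha.le hus.le
    have h10 := mul_nonneg hb.le hvs.le
    rw [abs_le]
    constructor <;> linarith
  have hql : ∀ x, 0 ≤ x → -(K / d1) ≤ q x := by
    intro x hx
    have h1 := h.e1 x hx
    have h2 := (abs_le.1 (hg x hx)).1
    have h3 := mul_nonneg hs (h.p0 x hx)
    rw [← neg_div, div_le_iff₀ hd1]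
    linarith
  have hpl : ∀ x, 0 ≤ x → p x ≤ P := by
    intro x hx
    have h1 := h.hφ.small h.hp hql (by positivity) hx one_pos
    have h2 := (h.b1 x hx).1
    have h3 := (h.b1 (x + 1) (by linarith)).2
    rw [hP]; linarith
  intro x hx
  refine ⟨(hpl x hx).trans (le_max_left _ _), le_trans ?_ (le_max_right _ _)⟩
  have h1 := h.e1 x hx
  have h2 := abs_le.1 (hg x hx)
  have h3 := mul_nonneg hs (h.p0 x hx)
  have h4 : s * p x ≤ S * P := mul_le_mul hsS (hpl x hx) (h.p0 x hx) hS
  apply abs_le_div_of hd1 <;> linarith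

lemma bounds2 {d1 d2 a b c d : ℝ} {F G : ℝ → ℝ} (hA : CondA F G) (us vs S : ℝ)
    (hd1 : 0 < d1) (hd2 : 0 < d2) (ha : 0 < a) (hb : 0 < b) (hc : 0 < c) (hd : 0 < d)
    (hus : 0 < us) (hvs : 0 < vs) (hS : 0 ≤ S) :
    ∃ M, 0 ≤ M ∧ ∀ s, 0 ≤ s → s ≤ S → ∀ φ p q ψ r t,
      WV d1 d2 a b c d F G us vs s φ p q ψ r t →
      ∀ x, 0 ≤ x → |p x| ≤ M ∧ |q x| ≤ M ∧ |r x| ≤ M ∧ |t x| ≤ M := by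
  obtain ⟨M1, h1, k1⟩ := bounds1 d2 c d hA us vs S hd1 ha hb hus hvs hS
  obtain ⟨M2, h2, k2⟩ := bounds1 d1 b a hA.symm vs us S hd2 hd hc hvs hus hS
  refine ⟨max M1 M2, le_max_of_le_left h1, ?_⟩
  intro s hs hsS φ p q ψ r t h x hx
  have e1 := k1 s hs hsS φ p q ψ r t h x hx
  have e2 := k2 s hs hsS ψ r t φ p q h.symm x hx
  rw [abs_of_nonneg (h.p0 x hx), abs_of_nonneg (h.r0 x hx)]
  exact ⟨e1.1.trans (le_max_left _ _), e1.2.trans (le_max_left _ _),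
    e2.1.trans (le_max_right _ _), e2.2.trans (le_max_right _ _)⟩

lemma bounds3 {d1 d2 a b c d : ℝ} {F G : ℝ → ℝ} (hA : CondA F G) (us vs S : ℝ)
    (hd1 : 0 < d1) (hd2 : 0 < d2) (ha : 0 < a) (hb : 0 < b) (hc : 0 < c) (hd : 0 < d)
    (hus : 0 < us) (hvs : 0 < vs) (hS : 0 ≤ S) :
    ∃ M, 0 ≤ M ∧ ∀ s, 0 ≤ s → s ≤ S → ∀ φ p q ψ r t,
      WV d1 d2 a b c d F G us vs s φ p q ψ r t →
      ∀ x y, 0 ≤ x → 0 ≤ y → |q y - q x| ≤ M * |y - x| := by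
  obtain ⟨M, h1, k1⟩ := bounds2 hA us vs S hd1 hd2 ha hb hc hd hus hvs hS
  obtain ⟨L, hL0, hL⟩ := lip_of_C2 hA.regF us
  refine ⟨(S * M + a * M + b * M + L * M) / d1, by positivity, ?_⟩
  intro s hs hsS φ p q ψ r t h x y hx hy
  have j1 := h.hφ.lip (fun z hz => (k1 s hs hsS φ p q ψ r t h z hz).1) hx hy
  have j2 := h.hp.lip (fun z hz => (k1 s hs hsS φ p q ψ r t h z hz).2.1) hx hy
  have j3 := h.hψ.lip (fun z hz => (k1 s hs hsS φ p q ψ r t h z hz).2.2.1) hx hy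
  have j4 := (hL _ (h.b1 x hx) _ (h.b1 y hy)).trans (mul_le_mul_of_nonneg_left j1 hL0)
  have i1 : s * |p y - p x| ≤ S * (M * |y - x|) := mul_le_mul hsS j2 (abs_nonneg _) hS
  have i2 := mul_le_mul_of_nonneg_left j1 ha.le
  have i3 := mul_le_mul_of_nonneg_left j3 hb.le
  rw [← abs_of_nonneg hs, ← abs_mul] at i1
  rw [← abs_of_pos ha, ← abs_mul, abs_of_pos ha] at i2
  rw [← abs_of_pos hb, ← abs_mul, abs_of_pos hb] at i3
  rw [abs_le] at i1 i2 i3 j4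
  have ex := h.e1 x hx
  have ey := h.e1 y hy
  rw [div_mul_eq_mul_div]
  apply abs_le_div_of hd1 <;> linarith

lemma final1 {d1 d2 a b c d : ℝ} {F G : ℝ → ℝ} (hA : CondA F G) (us vs S : ℝ)
    (hd1 : 0 < d1) (hd2 : 0 < d2) (ha : 0 < a) (hb : 0 < b) (hc : 0 < c) (hd : 0 < d)
    (hus : 0 < us) (hvs : 0 < vs) (hS : 0 ≤ S) :
    ∃ C, 0 < C ∧ ∀ s, 0 ≤ s → s ≤ S → ∀ φ p q ψ r t,
      WV d1 d2 a b c d F G us vs s φ p q ψ r t →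
      ∀ R x h η, 0 ≤ x → x ≤ R → 0 < h → h ≤ 1 → φ (R + 1) ≤ η → ψ (R + 1) ≤ η →
        |φ x| + |p x| + |q x| ≤ C * (η / h + h) := by
  obtain ⟨M, h1, k1⟩ := bounds2 hA us vs S hd1 hd2 ha hb hc hd hus hvs hS
  obtain ⟨L, hL0, hL⟩ := lip_of_C2 hA.regF us
  refine ⟨1 + (M + 1) + (S * (M + 1) + a + b + L) / d1, by positivity, ?_⟩
  intro s hs hsS φ p q ψ r t hw R x h η hx hxR hh hh1 hη1 hη2
  have hR : 0 ≤ R + 1 := by linarith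
  have mφ : ∀ y, 0 ≤ y → y ≤ R + 1 → φ y ≤ η := fun y hy hyR =>
    (hw.m1 (show y ∈ Ici 0 from hy) (show R + 1 ∈ Ici 0 from hR) hyR).trans hη1
  have mψ : ∀ y, 0 ≤ y → y ≤ R + 1 → ψ y ≤ η := fun y hy hyR =>
    (hw.m2 (show y ∈ Ici 0 from hy) (show R + 1 ∈ Ici 0 from hR) hyR).trans hη2
  have hη0 : 0 ≤ η := ((hw.b1 x hx).1).trans (mφ x hx (by linarith))
  have g1 : η ≤ η / h := by
    rw [le_div_iff₀ hh]
    exact mul_le_of_le_one_right hη0 hh1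
  obtain ⟨θ, hθ⟩ : ∃ θ, θ = η / h + h := ⟨_, rfl⟩
  have hθ0 : 0 ≤ θ := by rw [hθ]; positivity
  have g2 : φ x ≤ θ := (mφ x hx (by linarith)).trans (by linarith)
  have g3 : ψ x ≤ θ := (mψ x hx (by linarith)).trans (by linarith)
  have g4 : p x ≤ (M + 1) * θ := by
    have e1 := hw.hφ.small hw.hp
      (fun z hz => (abs_le.1 (k1 s hs hsS φ p q ψ r t hw z hz).2.1).1) h1 hx hh
    have e2 : (φ (x + h) - φ x) / h ≤ η / h := by
      apply div_le_div_of_nonneg_right _ hh.le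
      linarith [mφ (x + h) (by linarith) (by linarith), (hw.b1 x hx).1]
    have e3 : M * h ≤ M * θ := mul_le_mul_of_nonneg_left (by rw [hθ]; linarith) h1
    have e4 : η / h ≤ θ := by linarith
    linarith
  have g5 : F (φ x) ≤ L * θ := by
    have e1 := hL 0 ⟨le_refl _, hus.le⟩ (φ x) (hw.b1 x hx)
    rw [hA.zeroF, sub_zero, sub_zero, abs_of_nonneg (hw.b1 x hx).1] at e1
    exact ((le_abs_self _).trans e1).trans (mul_le_mul_of_nonneg_left g2 hL0)
  have g6 : 0 ≤ F (φ x) :=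
    hA.zeroF ▸ hA.monoF self_mem_Ici (show φ x ∈ Ici 0 from (hw.b1 x hx).1) (hw.b1 x hx).1
  have g7 : |q x| ≤ ((S * (M + 1) + a + b + L) * θ) / d1 := by
    have e1 := hw.e1 x hx
    have e2 : s * p x ≤ S * ((M + 1) * θ) := mul_le_mul hsS g4 (hw.p0 x hx) hS
    have e3 := mul_le_mul_of_nonneg_left g2 ha.le
    have e4 := mul_le_mul_of_nonneg_left g3 hb.le
    have e5 := mul_nonneg hs (hw.p0 x hx)
    have e6 := mul_nonneg ha.le (hw.b1 x hx).1
    have e7 := mul_nonneg hb.le (hw.b2 x hx).1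
    have e8 := mul_nonneg ha.le hθ0
    have e9 := mul_nonneg hb.le hθ0
    have e10 := mul_nonneg hL0 hθ0
    have e11 : 0 ≤ S * ((M + 1) * θ) := by positivity
    apply abs_le_div_of hd1 <;> linarith
  rw [abs_of_nonneg (hw.b1 x hx).1, abs_of_nonneg (hw.p0 x hx), ← hθ]
  calc _ ≤ θ + (M + 1) * θ + ((S * (M + 1) + a + b + L) * θ) / d1 := by linarith
    _ = _ := by ring

lemma gron {E E' : ℝ → ℝ} (h : HD E E') {K x1 : ℝ} (hx1 : 0 ≤ x1) (hE : ∀ x, 0 ≤ x → 0 ≤ E x)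
    (hK : ∀ x, 0 ≤ x → |E' x| ≤ K * E x) (h1 : E x1 = 0) : ∀ x, 0 ≤ x → E x = 0 := by
  have hexp : ∀ k x : ℝ, HasDerivWithinAt (fun x => Real.exp (k * x)) (Real.exp (k * x) * (k * 1))
      (Ici 0) x := fun k x => ((hasDerivWithinAt_id x _).const_mul k).exp
  intro x hx
  apply le_antisymm _ (hE x hx)
  rcases le_total x x1 with hxx | hxx
  · have hm : MonotoneOn (fun z => E z * Real.exp (K * z)) (Ici 0) := by
      refine HD.mono (f' := fun z => E' z * Real.exp (K * z) + E z * (Real.exp (K * z) * (K * 1)))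
        (fun z hz => (h z hz).mul (hexp K z)) ?_
      intro z hz
      have e1 := (abs_le.1 (hK z hz)).1
      have e2 := (Real.exp_pos (K * z)).le
      have : 0 ≤ (E' z + K * E z) * Real.exp (K * z) := mul_nonneg (by linarith) e2
      linarith
    have := hm (show x ∈ Ici 0 from hx) (show x1 ∈ Ici 0 from hx1) hxx
    simp only [h1, zero_mul] at this
    by_contra hcon
    push Not at hcon
    have := mul_pos hcon (Real.exp_pos (K * x))
    linarith
  · have hm : MonotoneOn (fun z => -E z * Real.exp (-K * z)) (Ici 0) := by
      refine HD.mono (f' := fun z => -E' z * Real.exp (-K * z) +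
        -E z * (Real.exp (-K * z) * (-K * 1)))
        (fun z hz => (h z hz).neg.mul (hexp (-K) z)) ?_
      intro z hz
      have e1 := (abs_le.1 (hK z hz)).2
      have e2 := (Real.exp_pos (-K * z)).le
      have : 0 ≤ (-E' z + K * E z) * Real.exp (-K * z) := mul_nonneg (by linarith) e2
      linarith
    have := hm (show x1 ∈ Ici 0 from hx1) (show x ∈ Ici 0 from hx) hxx
    simp only [h1, zero_mul, neg_zero] at this
    by_contra hcon
    push Not at hcon
    have := mul_pos hcon (Real.exp_pos (-K * x))
    linarith

lemma energy_alg {u p q v A : ℝ} (hA : 0 ≤ A) (hq : |q| ≤ A * (|p| + |u| + |v|)) :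
    |2 * u * p + 2 * p * q| ≤ (1 + 4 * A) * (u ^ 2 + p ^ 2 + v ^ 2) := by
  have h1 : |2 * u * p| ≤ u ^ 2 + p ^ 2 := by
    rw [abs_le]; constructor <;> nlinarith [sq_nonneg (u - p), sq_nonneg (u + p)]
  have h2 : |2 * p * q| ≤ 4 * A * (u ^ 2 + p ^ 2 + v ^ 2) := by
    rw [abs_mul, abs_mul, abs_two]
    have e1 : 2 * |p| * |q| ≤ 2 * |p| * (A * (|p| + |u| + |v|)) :=
      mul_le_mul_of_nonneg_left hq (by positivity)
    have e2 : 2 * |p| * (|p| + |u| + |v|) ≤ 4 * (u ^ 2 + p ^ 2 + v ^ 2) := by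
      rw [← sq_abs u, ← sq_abs p, ← sq_abs v]
      nlinarith [sq_nonneg (|p| - |u|), sq_nonneg (|p| - |v|), sq_nonneg (|u|), sq_nonneg (|v|)]
    have e3 := mul_le_mul_of_nonneg_left e2 hA
    linarith
  have h3 := abs_add_le (2 * u * p) (2 * p * q)
  have h4 : 0 ≤ v ^ 2 := sq_nonneg v
  linarith

lemma qbound {d1 d2 a b c d : ℝ} {F G : ℝ → ℝ} (hA : CondA F G) {us vs s : ℝ}
    (hd1 : 0 < d1) (ha : 0 < a) (hb : 0 < b) (hs : 0 ≤ s)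
    {φ p q ψ r t : ℝ → ℝ} (h : WV d1 d2 a b c d F G us vs s φ p q ψ r t) {x1 : ℝ} (hx1 : 0 ≤ x1)
    (e1 : -a * φ x1 + b * ψ x1 - F (φ x1) = 0) :
    ∃ A, 0 ≤ A ∧ ∀ x, 0 ≤ x → |q x| ≤ A * (|p x| + |φ x - φ x1| + |ψ x - ψ x1|) := by
  obtain ⟨L, hL0, hL⟩ := lip_of_C2 hA.regF us
  refine ⟨(s + a + L + b) / d1, by positivity, ?_⟩
  intro x hx
  have k1 := h.e1 x hx
  have k2 := abs_le.1 (hL _ (h.b1 x1 hx1) _ (h.b1 x hx))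
  obtain ⟨T, hT⟩ : ∃ T, T = |p x| + |φ x - φ x1| + |ψ x - ψ x1| := ⟨_, rfl⟩
  have n1 := abs_nonneg (p x)
  have n2 := abs_nonneg (φ x - φ x1)
  have n3 := abs_nonneg (ψ x - ψ x1)
  have i1 : |s * p x| ≤ s * T := by
    rw [abs_mul, abs_of_nonneg hs]; exact mul_le_mul_of_nonneg_left (by linarith) hs
  have i2 : |a * (φ x - φ x1)| ≤ a * T := by
    rw [abs_mul, abs_of_pos ha]; exact mul_le_mul_of_nonneg_left (by linarith) ha.le
  have i3 : |b * (ψ x - ψ x1)| ≤ b * T := by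
    rw [abs_mul, abs_of_pos hb]; exact mul_le_mul_of_nonneg_left (by linarith) hb.le
  have i4 : L * |φ x - φ x1| ≤ L * T := mul_le_mul_of_nonneg_left (by linarith) hL0
  rw [abs_le] at i1 i2 i3
  rw [← hT, div_mul_eq_mul_div]
  apply abs_le_div_of hd1 <;> linarith

lemma const_zero {d1 d2 a b c d : ℝ} {F G : ℝ → ℝ} (hA : CondA F G) {us vs s : ℝ}
    (hd1 : 0 < d1) (hd2 : 0 < d2) (ha : 0 < a) (hb : 0 < b) (hc : 0 < c) (hd : 0 < d) (hs : 0 ≤ s)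
    {φ p q ψ r t : ℝ → ℝ} (h : WV d1 d2 a b c d F G us vs s φ p q ψ r t) {x1 : ℝ} (hx1 : 0 ≤ x1)
    (e1 : -a * φ x1 + b * ψ x1 - F (φ x1) = 0) (e2 : -d * ψ x1 + c * φ x1 - G (ψ x1) = 0)
    (hp : p x1 = 0) (hr : r x1 = 0) : ∀ x, 0 ≤ x → φ x = 0 ∧ ψ x = 0 := by
  obtain ⟨A, hA0, k1⟩ := qbound hA hd1 ha hb hs h hx1 e1
  obtain ⟨B, hB0, k2⟩ := qbound hA.symm hd2 hd hc hs h.symm hx1 e2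
  have key := gron (E := fun x => (φ x - φ x1) ^ 2 + (p x) ^ 2 + ((ψ x - ψ x1) ^ 2 + (r x) ^ 2))
    (E' := fun x => ((2:ℕ) * (φ x - φ x1) ^ (2 - 1) * p x + (2:ℕ) * (p x) ^ (2 - 1) * q x) +
      ((2:ℕ) * (ψ x - ψ x1) ^ (2 - 1) * r x + (2:ℕ) * (r x) ^ (2 - 1) * t x))
    (K := (1 + 4 * A) + (1 + 4 * B)) (x1 := x1)
    (fun x hx => ((((h.hφ x hx).sub_const _).pow 2).add ((h.hp x hx).pow 2)).add
      ((((h.hψ x hx).sub_const _).pow 2).add ((h.hr x hx).pow 2))) hx1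
    (fun x hx => by positivity)
    (fun x hx => by
      have j1 := energy_alg hA0 (k1 x hx)
      have j2 := energy_alg hB0 (k2 x hx)
      norm_num
      refine (abs_add_le _ _).trans ?_
      have j3 : 0 ≤ (1 + 4 * A) * (r x) ^ 2 := by positivity
      have j4 : 0 ≤ (1 + 4 * B) * (p x) ^ 2 := by positivity
      linarith)
    (by simp [hp, hr])
  have key2 : ∀ x, 0 ≤ x → φ x = φ x1 ∧ ψ x = ψ x1 := by
    intro x hx
    have := key x hx
    have n1 := sq_nonneg (φ x - φ x1)
    have n2 := sq_nonneg (p x)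
    have n3 := sq_nonneg (ψ x - ψ x1)
    have n4 := sq_nonneg (r x)
    constructor
    · have : (φ x - φ x1) ^ 2 = 0 := by linarith
      exact sub_eq_zero.1 (pow_eq_zero_iff (two_ne_zero) |>.1 this)
    · have : (ψ x - ψ x1) ^ 2 = 0 := by linarith
      exact sub_eq_zero.1 (pow_eq_zero_iff (two_ne_zero) |>.1 this)
  intro x hx
  have a1 := key2 0 le_rfl
  rw [h.z1, h.z2] at a1
  have a2 := key2 x hx
  exact ⟨a2.1.trans a1.1.symm, a2.2.trans a1.2.symm⟩

lemma HD.const {f f' : ℝ → ℝ} (h : HD f f') {x y C : ℝ} (hx : 0 ≤ x)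
    (hc : ∀ z ∈ Ioo x y, f z = C) : ∀ z ∈ Ioo x y, f' z = 0 := by
  intro z hz
  have h1 := h.at (lt_of_le_of_lt hx hz.1)
  have h2 : HasDerivAt f 0 z := by
    refine (hasDerivAt_const z C).congr_of_eventuallyEq ?_
    filter_upwards [Ioo_mem_nhds hz.1 hz.2] with w hw using hc w hw
  exact h1.unique h2

lemma strict_of {d1 d2 a b c d : ℝ} {F G : ℝ → ℝ} (hA : CondA F G) {us vs s : ℝ}
    (hd1 : 0 < d1) (hd2 : 0 < d2) (ha : 0 < a) (hb : 0 < b) (hc : 0 < c) (hd : 0 < d) (hs : 0 ≤ s)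
    {φ p q ψ r t : ℝ → ℝ} (h : WV d1 d2 a b c d F G us vs s φ p q ψ r t) {x0 : ℝ} (hx0 : 0 ≤ x0)
    (hne : 0 < φ x0 + ψ x0) : StrictMonoOn φ (Ici 0) := by
  intro x hx y hy hxy
  refine lt_of_le_of_ne (h.m1 hx hy hxy.le) fun heq => ?_
  have hx' : 0 ≤ x := hx
  have c1 : ∀ z ∈ Ioo x y, φ z = φ x := by
    intro z hz
    have hz0 : z ∈ Ici 0 := hx'.trans hz.1.le
    exact le_antisymm ((h.m1 hz0 hy hz.2.le).trans heq.symm.le) (h.m1 hx hz0 hz.1.le)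
  have c2 := h.hφ.const hx' c1
  have c3 := h.hp.const hx' c2
  have c4 : ∀ z ∈ Ioo x y, ψ z = (a * φ x + F (φ x)) / b := by
    intro z hz
    have := h.e1 z (hx'.trans hz.1.le)
    rw [c1 z hz, c2 z hz, c3 z hz] at this
    field_simp
    linarith
  have c5 := h.hψ.const hx' c4
  have c6 := h.hr.const hx' c5
  have hm : (x + y) / 2 ∈ Ioo x y := ⟨by linarith, by linarith⟩
  have hm0 : 0 ≤ (x + y) / 2 := hx'.trans hm.1.le
  have f1 := h.e1 _ hm0
  have f2 := h.e2 _ hm0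
  rw [c2 _ hm, c3 _ hm] at f1
  rw [c5 _ hm, c6 _ hm] at f2
  have := const_zero hA hd1 hd2 ha hb hc hd hs h hm0 (by linarith) (by linarith) (c2 _ hm)
    (c5 _ hm) x0 hx0
  rw [this.1, this.2] at hne
  linarith

lemma mono_lim {φ : ℝ → ℝ} {u : ℝ} (h : MonotoneOn φ (Ici 0)) (hb : ∀ x, 0 ≤ x → φ x ≤ u) :
    ∃ U, Tendsto φ atTop (𝓝 U) := by
  have hm : Monotone (fun x => φ (max x 0)) := fun x y hxy =>
    h (mem_Ici.2 (le_max_right x 0)) (mem_Ici.2 (le_max_right y 0))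
      (max_le_max_right 0 hxy)
  have := tendsto_atTop_ciSup hm ⟨u, by rintro _ ⟨x, rfl⟩; exact hb _ (le_max_right _ _)⟩
  refine ⟨_, this.congr' ?_⟩
  filter_upwards [eventually_ge_atTop 0] with x hx
  rw [max_eq_left hx]

lemma deriv_lim_zero {H H' : ℝ → ℝ} (h : HD H H') {B l : ℝ} (hB : ∀ x, 0 ≤ x → |H x| ≤ B)
    (hl : Tendsto H' atTop (𝓝 l)) : l = 0 := by
  have hex : ∀ n : ℕ, ∃ y : ℝ, (n:ℝ) ≤ y ∧ |H' y| ≤ 2 * B / ((n:ℝ) + 1) := by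
    intro n
    have hn : (0:ℝ) ≤ n := n.cast_nonneg
    obtain ⟨y, hy, hy2⟩ := exists_hasDerivAt_eq_slope H H'
      (show (n:ℝ) < n + (n + 1) by linarith)
      (h.cont.mono fun z hz => le_trans hn hz.1)
      (fun z hz => h.at (lt_of_le_of_lt hn hz.1))
    refine ⟨y, hy.1.le, ?_⟩
    have e : (n:ℝ) + (n + 1) - n = n + 1 := by ring
    rw [hy2, e, abs_div, abs_of_pos (show (0:ℝ) < n + 1 by linarith)]
    apply div_le_div_of_nonneg_right _ (by linarith)
    have := abs_sub (H ((n:ℝ) + (n + 1))) (H n)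
    linarith [hB _ (show (0:ℝ) ≤ (n:ℝ) + (n + 1) by linarith), hB _ hn]
  choose y hy1 hy2 using hex
  have hy : Tendsto y atTop atTop := tendsto_atTop_mono hy1 tendsto_natCast_atTop_atTop
  have t1 := hl.comp hy
  have t2 : Tendsto (fun n : ℕ => 2 * B / ((n:ℝ) + 1)) atTop (𝓝 0) :=
    tendsto_const_nhds.div_atTop (tendsto_atTop_add_const_right _ _ tendsto_natCast_atTop_atTop)
  have t3 : Tendsto (H' ∘ y) atTop (𝓝 0) := squeeze_zero_norm hy2 t2
  exact tendsto_nhds_unique t1 t3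

lemma wv_lim_eq {d1 d2 a b c d : ℝ} {F G : ℝ → ℝ} (hA : CondA F G) {us vs s : ℝ}
    (hd1 : 0 < d1) (hs : 0 ≤ s)
    {φ p q ψ r t : ℝ → ℝ} (h : WV d1 d2 a b c d F G us vs s φ p q ψ r t) {M U V : ℝ}
    (hM : ∀ x, 0 ≤ x → |p x| ≤ M) (hU : Tendsto φ atTop (𝓝 U)) (hV : Tendsto ψ atTop (𝓝 V))
    (hU0 : 0 ≤ U) : a * U - b * V + F U = 0 := by
  have hF : Tendsto (fun x => F (φ x)) atTop (𝓝 (F U)) := by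
    refine (hA.regF.continuousOn U hU0).tendsto.comp ?_
    refine tendsto_nhdsWithin_iff.2 ⟨hU, ?_⟩
    filter_upwards [eventually_ge_atTop 0] with x hx using (h.b1 x hx).1
  refine deriv_lim_zero (H := fun x => d1 * p x - s * φ x) (H' := fun x => d1 * q x - s * p x)
    (B := d1 * M + s * us) ?_ ?_ ?_
  · intro x hx
    exact ((h.hp x hx).const_mul d1).sub ((h.hφ x hx).const_mul s)
  · intro x hx
    refine (abs_sub _ _).trans ?_
    rw [abs_mul, abs_mul, abs_of_pos hd1, abs_of_nonneg hs, abs_of_nonneg (h.b1 x hx).1]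
    have := mul_le_mul_of_nonneg_left (hM x hx) hd1.le
    have := mul_le_mul_of_nonneg_left (h.b1 x hx).2 hs
    linarith
  · refine (((hU.const_mul a).sub (hV.const_mul b)).add hF).congr' ?_
    filter_upwards [eventually_ge_atTop 0] with x hx
    linarith [h.e1 x hx]

lemma eq_unique {a b c d : ℝ} {F G : ℝ → ℝ} (hA : CondA F G) (ha : 0 < a) (hd : 0 < d)
    {us vs U V : ℝ} (h : IsEquilibrium a b c d F G us vs)
    (h' : IsEquilibrium a b c d F G U V) (hU : U ≤ us) (hV : V ≤ vs) : U = us ∧ V = vs := by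
  obtain ⟨p1, p2, p3, p4⟩ := h
  obtain ⟨q1, q2, q3, q4⟩ := h'
  have key : ∀ u v, 0 < u → 0 < v → -a * u + b * v - F u = 0 → c * u - d * v - G v = 0 →
      (a + F u / u) * (d + G v / v) = b * c := by
    intro u v hu hv h1 h2
    have e1 : F u = -a * u + b * v := by linarith
    have e2 : G v = c * u - d * v := by linarith
    rw [e1, e2]; field_simp; ring
  have k1 := key us vs p1 p2 p3 p4
  have k2 := key U V q1 q2 q3 q4
  have m1 := hA.ratioF.monotoneOn (show U ∈ Ioi 0 from q1) (show us ∈ Ioi 0 from p1) hU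
  have m2 := hA.ratioG.monotoneOn (show V ∈ Ioi 0 from q2) (show vs ∈ Ioi 0 from p2) hV
  beta_reduce at m1 m2
  have hFp : 0 ≤ F U / U := div_nonneg
    (hA.zeroF ▸ hA.monoF self_mem_Ici (show U ∈ Ici 0 from q1.le) q1.le) q1.le
  have hGp : 0 ≤ G V / V := div_nonneg
    (hA.zeroG ▸ hA.monoG self_mem_Ici (show V ∈ Ici 0 from q2.le) q2.le) q2.le
  constructor
  · by_contra hne
    have m3 := hA.ratioF (show U ∈ Ioi 0 from q1) (show us ∈ Ioi 0 from p1) (lt_of_le_of_ne hU hne)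
    beta_reduce at m3
    have : (a + F U / U) * (d + G V / V) < (a + F us / us) * (d + G vs / vs) :=
      mul_lt_mul (by linarith) (by linarith) (by linarith) (by linarith)
    linarith
  · by_contra hne
    have m3 := hA.ratioG (show V ∈ Ioi 0 from q2) (show vs ∈ Ioi 0 from p2) (lt_of_le_of_ne hV hne)
    beta_reduce at m3
    have : (a + F U / U) * (d + G V / V) < (a + F us / us) * (d + G vs / vs) :=
      mul_lt_mul' (by linarith) (by linarith) (by linarith) (by linarith)
    linarith

lemma HD.derivWithin {f f' : ℝ → ℝ} (h : HD f f') {x : ℝ} (hx : 0 ≤ x) :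
    derivWithin f (Ici 0) x = f' x := (h x hx).derivWithin (uniqueDiffOn_Ici 0 x hx)

lemma C2_of {φ p q : ℝ → ℝ} (h1 : HD φ p) (h2 : HD p q) (hq : ContinuousOn q (Ici 0)) :
    ContDiffOn ℝ 2 φ (Ici 0) := by
  have e1 : ContDiffOn ℝ 1 p (Ici 0) := by
    rw [show (1 : WithTop ℕ∞) = 0 + 1 by norm_num,
      contDiffOn_succ_iff_derivWithin (uniqueDiffOn_Ici 0)]
    refine ⟨fun x hx => (h2 x hx).differentiableWithinAt, by simp, ?_⟩
    rw [contDiffOn_zero]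
    exact hq.congr fun x hx => h2.derivWithin hx
  rw [show (2 : WithTop ℕ∞) = 1 + 1 by norm_num,
    contDiffOn_succ_iff_derivWithin (uniqueDiffOn_Ici 0)]
  refine ⟨fun x hx => (h1 x hx).differentiableWithinAt, by simp, ?_⟩
  exact e1.congr fun x hx => h1.derivWithin hx

lemma HD.deriv2 {φ p q : ℝ → ℝ} (h1 : HD φ p) (h2 : HD p q) {x : ℝ} (hx : 0 < x) :
    deriv φ x = p x ∧ deriv (deriv φ) x = q x := by
  refine ⟨(h1.at hx).deriv, ?_⟩
  have : deriv φ =ᶠ[𝓝 x] p := by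
    filter_upwards [Ioi_mem_nhds hx] with y hy using (h1.at hy).deriv
  rw [this.deriv_eq]
  exact (h2.at hx).deriv

lemma q_cont {d1 d2 a b c d : ℝ} {F G : ℝ → ℝ} (hA : CondA F G) {us vs s : ℝ}
    (hd1 : 0 < d1) {φ p q ψ r t : ℝ → ℝ} (h : WV d1 d2 a b c d F G us vs s φ p q ψ r t) :
    ContinuousOn q (Ici 0) := by
  have f1 : ContinuousOn (fun x => F (φ x)) (Ici 0) :=
    hA.regF.continuousOn.comp h.hφ.cont fun x hx => (h.b1 x hx).1
  have : ContinuousOn (fun x => (s * p x + a * φ x - b * ψ x + F (φ x)) / d1) (Ici 0) :=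
    ((((continuousOn_const.mul h.hp.cont).add (continuousOn_const.mul h.hφ.cont)).sub
      (continuousOn_const.mul h.hψ.cont)).add f1).div_const _
  refine this.congr fun x hx => ?_
  have := h.e1 x hx
  field_simp
  linarith

lemma inc_of {d1 d2 a b c d : ℝ} {F G : ℝ → ℝ} (hA : CondA F G) {us vs s : ℝ}
    (hd1 : 0 < d1) (hd2 : 0 < d2) (ha : 0 < a) (hb : 0 < b) (hc : 0 < c) (hd : 0 < d) (hs : 0 ≤ s)
    (hEq : IsEquilibrium a b c d F G us vs)
    {φ p q ψ r t : ℝ → ℝ} (h : WV d1 d2 a b c d F G us vs s φ p q ψ r t) {x0 : ℝ} (hx0 : 0 ≤ x0)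
    (hne : 0 < φ x0 + ψ x0) : IncSemiWave d1 d2 a b c d F G us vs s φ ψ := by
  have s1 := strict_of hA hd1 hd2 ha hb hc hd hs h hx0 hne
  have s2 := strict_of hA.symm hd2 hd1 hd hc hb ha hs h.symm hx0 (by linarith)
  obtain ⟨U, hU⟩ := mono_lim h.m1 fun x hx => (h.b1 x hx).2
  obtain ⟨V, hV⟩ := mono_lim h.m2 fun x hx => (h.b2 x hx).2
  obtain ⟨M, -, hM⟩ := bounds2 hA us vs s hd1 hd2 ha hb hc hd hEq.1 hEq.2.1 hs
  have hM' := hM s hs le_rfl φ p q ψ r t h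
  have pos : ∀ f : ℝ → ℝ, ∀ L, f 0 = 0 → StrictMonoOn f (Ici 0) → Tendsto f atTop (𝓝 L) →
      0 < L := by
    intro f L f0 hf hL
    have e1 := hf self_mem_Ici (mem_Ici.2 (zero_le_one (α := ℝ))) zero_lt_one
    have e2 := mono_le_lim hf.monotoneOn hL zero_le_one
    linarith
  have hU0 := pos φ U h.z1 s1 hU
  have hV0 := pos ψ V h.z2 s2 hV
  have l1 := wv_lim_eq hA hd1 hs h (fun x hx => (hM' x hx).1) hU hV hU0.le
  have l2 := wv_lim_eq hA.symm hd2 hs h.symm (fun x hx => (hM' x hx).2.2.1) hV hU hV0.le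
  have hUle : U ≤ us := by
    refine le_of_tendsto hU ?_
    filter_upwards [eventually_ge_atTop 0] with x hx using (h.b1 x hx).2
  have hVle : V ≤ vs := by
    refine le_of_tendsto hV ?_
    filter_upwards [eventually_ge_atTop 0] with x hx using (h.b2 x hx).2
  obtain ⟨rfl, rfl⟩ := eq_unique hA ha hd hEq ⟨hU0, hV0, by linarith, by linarith⟩ hUle hVle
  refine ⟨⟨C2_of h.hφ h.hp (q_cont hA hd1 h), C2_of h.hψ h.hr (q_cont hA.symm hd2 h.symm),
    ?_, ?_, h.z1, h.z2, hU, hV⟩, s1, s2⟩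
  · intro x hx
    obtain ⟨g1, g2⟩ := h.hφ.deriv2 h.hp hx
    rw [g1, g2]
    exact h.e1 x hx.le
  · intro x hx
    obtain ⟨g1, g2⟩ := h.hψ.deriv2 h.hr hx
    rw [g1, g2]
    linarith [h.e2 x hx.le]

lemma ulim (U : Ultrafilter ℝ) {m M : ℝ} {f : ℝ → ℝ → ℝ}
    (h : ∀ᶠ s in (U : Filter ℝ), ∀ x, 0 ≤ x → f s x ∈ Icc m M) :
    ∃ g : ℝ → ℝ, ∀ x, 0 ≤ x → Tendsto (fun s => f s x) U (𝓝 (g x)) := by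
  have : ∀ x, ∃ y, 0 ≤ x → Tendsto (fun s => f s x) U (𝓝 y) := by
    intro x
    by_cases hx : 0 ≤ x
    · obtain ⟨y, -, hy⟩ := (isCompact_Icc (a := m) (b := M)).ultrafilter_le_nhds'
        (U.map fun s => f s x) (by
          rw [Ultrafilter.mem_map]
          filter_upwards [h] with s hs using hs x hx)
      exact ⟨y, fun _ => hy⟩
    · exact ⟨0, fun h => absurd h hx⟩
  choose g hg using this
  exact ⟨g, hg⟩

lemma lim_WV {d1 d2 a b c d : ℝ} {F G : ℝ → ℝ} (hA : CondA F G) {us vs S : ℝ}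
    (hd1 : 0 < d1) (hd2 : 0 < d2) (ha : 0 < a) (hb : 0 < b) (hc : 0 < c) (hd : 0 < d) (hS : 0 ≤ S)
    (hus : 0 < us) (hvs : 0 < vs) (U : Ultrafilter ℝ) (hUS : Tendsto id (U : Filter ℝ) (𝓝 S))
    (hU2 : ∀ᶠ s in (U : Filter ℝ), 0 ≤ s ∧ s ≤ S) {φ p q ψ r t : ℝ → ℝ → ℝ}
    (h : ∀ᶠ s in (U : Filter ℝ),
      WV d1 d2 a b c d F G us vs s (φ s) (p s) (q s) (ψ s) (r s) (t s)) :
    ∃ φ' p' q' ψ' r' t', WV d1 d2 a b c d F G us vs S φ' p' q' ψ' r' t' ∧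
      (∀ x, 0 ≤ x → Tendsto (fun s => φ s x) U (𝓝 (φ' x))) ∧
      (∀ x, 0 ≤ x → Tendsto (fun s => ψ s x) U (𝓝 (ψ' x))) := by
  obtain ⟨M, hM0, hM⟩ := bounds2 hA us vs S hd1 hd2 ha hb hc hd hus hvs hS
  obtain ⟨N1, hN10, hN1⟩ := bounds3 hA us vs S hd1 hd2 ha hb hc hd hus hvs hS
  obtain ⟨N2, hN20, hN2⟩ := bounds3 hA.symm vs us S hd2 hd1 hd hc hb ha hvs hus hS
  obtain ⟨φ', lφ⟩ := ulim U (f := φ) (m := 0) (M := us) (by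
    filter_upwards [h] with s hs using hs.b1)
  obtain ⟨ψ', lψ⟩ := ulim U (f := ψ) (m := 0) (M := vs) (by
    filter_upwards [h] with s hs using hs.b2)
  obtain ⟨p', lp⟩ := ulim U (f := p) (m := -M) (M := M) (by
    filter_upwards [h, hU2] with s hs hs2 x hx
    exact abs_le.1 (hM s hs2.1 hs2.2 _ _ _ _ _ _ hs x hx).1)
  obtain ⟨q', lq⟩ := ulim U (f := q) (m := -M) (M := M) (by
    filter_upwards [h, hU2] with s hs hs2 x hx
    exact abs_le.1 (hM s hs2.1 hs2.2 _ _ _ _ _ _ hs x hx).2.1)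
  obtain ⟨r', lr⟩ := ulim U (f := r) (m := -M) (M := M) (by
    filter_upwards [h, hU2] with s hs hs2 x hx
    exact abs_le.1 (hM s hs2.1 hs2.2 _ _ _ _ _ _ hs x hx).2.2.1)
  obtain ⟨t', lt⟩ := ulim U (f := t) (m := -M) (M := M) (by
    filter_upwards [h, hU2] with s hs hs2 x hx
    exact abs_le.1 (hM s hs2.1 hs2.2 _ _ _ _ _ _ hs x hx).2.2.2)
  have bφ : ∀ x, 0 ≤ x → φ' x ∈ Icc 0 us := fun x hx =>
    isClosed_Icc.mem_of_tendsto (lφ x hx) (by filter_upwards [h] with s hs using hs.b1 x hx)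
  have bψ : ∀ x, 0 ≤ x → ψ' x ∈ Icc 0 vs := fun x hx =>
    isClosed_Icc.mem_of_tendsto (lψ x hx) (by filter_upwards [h] with s hs using hs.b2 x hx)
  have lF : ∀ x, 0 ≤ x → Tendsto (fun s => F (φ s x)) U (𝓝 (F (φ' x))) := by
    intro x hx
    refine (hA.regF.continuousOn _ (bφ x hx).1).tendsto.comp ?_
    refine tendsto_nhdsWithin_iff.2 ⟨lφ x hx, ?_⟩
    filter_upwards [h] with s hs using (hs.b1 x hx).1
  have lG : ∀ x, 0 ≤ x → Tendsto (fun s => G (ψ s x)) U (𝓝 (G (ψ' x))) := by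
    intro x hx
    refine (hA.regG.continuousOn _ (bψ x hx).1).tendsto.comp ?_
    refine tendsto_nhdsWithin_iff.2 ⟨lψ x hx, ?_⟩
    filter_upwards [h] with s hs using (hs.b2 x hx).1
  refine ⟨φ', p', q', ψ', r', t', ⟨?_, ?_, ?_, ?_, ?_, ?_, ?_, ?_, bφ, bψ, ?_, ?_, ?_, ?_⟩, lφ, lψ⟩
  · refine HD.limit hM0 (by filter_upwards [h] with s hs using hs.hφ) ?_ lφ lp
    filter_upwards [h, hU2] with s hs hs2 x y hx hy
    exact hs.hp.lip (fun z hz => (hM s hs2.1 hs2.2 _ _ _ _ _ _ hs z hz).2.1) hx hy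
  · refine HD.limit hN10 (by filter_upwards [h] with s hs using hs.hp) ?_ lp lq
    filter_upwards [h, hU2] with s hs hs2
    exact hN1 s hs2.1 hs2.2 _ _ _ _ _ _ hs
  · refine HD.limit hM0 (by filter_upwards [h] with s hs using hs.hψ) ?_ lψ lr
    filter_upwards [h, hU2] with s hs hs2 x y hx hy
    exact hs.hr.lip (fun z hz => (hM s hs2.1 hs2.2 _ _ _ _ _ _ hs z hz).2.2.2) hx hy
  · refine HD.limit hN20 (by filter_upwards [h] with s hs using hs.hr) ?_ lr lt
    filter_upwards [h, hU2] with s hs hs2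
    exact hN2 s hs2.1 hs2.2 _ _ _ _ _ _ hs.symm
  · intro x hx
    refine tendsto_nhds_unique (((((lq x hx).const_mul d1).sub (hUS.mul (lp x hx))).sub
      ((lφ x hx).const_mul a)).add ((lψ x hx).const_mul b) |>.sub (lF x hx)) ?_
    refine tendsto_const_nhds.congr' ?_
    filter_upwards [h] with s hs using (hs.e1 x hx).symm
  · intro x hx
    refine tendsto_nhds_unique (((((lt x hx).const_mul d2).sub (hUS.mul (lr x hx))).sub
      ((lψ x hx).const_mul d)).add ((lφ x hx).const_mul c) |>.sub (lG x hx)) ?_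
    refine tendsto_const_nhds.congr' ?_
    filter_upwards [h] with s hs using (hs.e2 x hx).symm
  · refine tendsto_nhds_unique (lφ 0 le_rfl) (tendsto_const_nhds.congr' ?_)
    filter_upwards [h] with s hs using hs.z1.symm
  · refine tendsto_nhds_unique (lψ 0 le_rfl) (tendsto_const_nhds.congr' ?_)
    filter_upwards [h] with s hs using hs.z2.symm
  · intro x hx y hy hxy
    refine le_of_tendsto_of_tendsto (lφ x hx) (lφ y hy) ?_
    filter_upwards [h] with s hs using hs.m1 hx hy hxy
  · intro x hx y hy hxy
    refine le_of_tendsto_of_tendsto (lψ x hx) (lψ y hy) ?_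
    filter_upwards [h] with s hs using hs.m2 hx hy hxy
  · intro x hx
    refine ge_of_tendsto (lp x hx) ?_
    filter_upwards [h] with s hs using hs.p0 x hx
  · intro x hx
    refine ge_of_tendsto (lr x hx) ?_
    filter_upwards [h] with s hs using hs.r0 x hx

theorem statement7
    (d1 d2 a b c d : ℝ)
    (hd1 : 0 < d1) (hd2 : 0 < d2) (ha : 0 < a) (hb : 0 < b) (hc : 0 < c) (hd : 0 < d)
    (hbcad : 0 < b * c - a * d)
    (F G : ℝ → ℝ) (hA : CondA F G)
    (ustar vstar : ℝ) (hEq : IsEquilibrium a b c d F G ustar vstar)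
    (sstar : ℝ) (hcrit : IsCriticalSpeed d1 d2 a b c d F G ustar vstar sstar)
    (Φ Ψ : ℝ → ℝ → ℝ)
    (hfam : ∀ s, 0 ≤ s → s < sstar →
      IncSemiWave d1 d2 a b c d F G ustar vstar s (Φ s) (Ψ s)) :
    ∀ R > (0:ℝ), ∀ ε > (0:ℝ), ∃ δ > (0:ℝ), ∀ s, 0 ≤ s → sstar - δ < s → s < sstar →
      ∀ ξ ∈ Icc (0:ℝ) R,
        |Φ s ξ| + |derivWithin (Φ s) (Ici 0) ξ| +
          |derivWithin (derivWithin (Φ s) (Ici 0)) (Ici 0) ξ| < ε ∧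
        |Ψ s ξ| + |derivWithin (Ψ s) (Ici 0) ξ| +
          |derivWithin (derivWithin (Ψ s) (Ici 0)) (Ici 0) ξ| < ε := by

  obtain ⟨hS, -, hno⟩ := hcrit
  intro R hR ε hε
  have hWV := fun s hs hs' => WV.of_wave hA (hfam s hs hs')
  -- pointwise smallness
  have hpt : ∀ η > (0:ℝ), ∀ᶠ s in 𝓝[<] sstar, Φ s (R + 1) + Ψ s (R + 1) < η := by
    intro η hη
    by_contra hcon
    rw [Filter.not_eventually] at hcon
    have hev : ∀ᶠ s in 𝓝[<] sstar, 0 ≤ s ∧ s < sstar := by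
      filter_upwards [self_mem_nhdsWithin, nhdsWithin_le_nhds (Ioi_mem_nhds hS)] with s h1 h2
      exact ⟨le_of_lt h2, h1⟩
    have hne : (𝓝[<] sstar ⊓ 𝓟 {s | ¬ Φ s (R + 1) + Ψ s (R + 1) < η}).NeBot :=
      Filter.frequently_mem_iff_neBot.1 hcon
    obtain ⟨U, hU⟩ := Ultrafilter.exists_le (𝓝[<] sstar ⊓ 𝓟 {s | ¬ Φ s (R + 1) + Ψ s (R + 1) < η})
    have hU1 : (U : Filter ℝ) ≤ 𝓝[<] sstar := hU.trans inf_le_left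
    have hU2 : ∀ᶠ s in (U : Filter ℝ), ¬ Φ s (R + 1) + Ψ s (R + 1) < η :=
      (hU.trans inf_le_right) (mem_principal_self _)
    have hU3 : ∀ᶠ s in (U : Filter ℝ), 0 ≤ s ∧ s < sstar := hU1 hev
    obtain ⟨φ', p', q', ψ', r', t', hW, l1, l2⟩ := lim_WV hA hd1 hd2 ha hb hc hd hS.le hEq.1 hEq.2.1
      U (hU1.trans nhdsWithin_le_nhds) (hU3.mono fun s hs => ⟨hs.1, hs.2.le⟩)
      (hU3.mono fun s hs => hWV s hs.1 hs.2)
    have hR1 : 0 ≤ R + 1 := by linarith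
    have hge : η ≤ φ' (R + 1) + ψ' (R + 1) := by
      refine ge_of_tendsto ((l1 _ hR1).add (l2 _ hR1)) ?_
      filter_upwards [hU2] with s hs using not_lt.1 hs
    exact hno sstar le_rfl ⟨φ', ψ', inc_of hA hd1 hd2 ha hb hc hd hS.le hEq hW hR1 (by linarith)⟩
  obtain ⟨C1, hC1, k1⟩ := final1 hA ustar vstar sstar hd1 hd2 ha hb hc hd hEq.1 hEq.2.1 hS.le
  obtain ⟨C2, hC2, k2⟩ := final1 hA.symm vstar ustar sstar hd2 hd1 hd hc hb ha hEq.2.1 hEq.1 hS.le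
  obtain ⟨h, hh⟩ : ∃ h, h = min 1 (ε / (3 * (C1 + C2))) := ⟨_, rfl⟩
  have hh0 : 0 < h := by rw [hh]; positivity
  have hh1 : h ≤ 1 := by rw [hh]; exact min_le_left _ _
  have hh2 : h * (3 * (C1 + C2)) ≤ ε := by
    rw [← le_div_iff₀ (by positivity), hh]; exact min_le_right _ _
  have hev := hpt (h * h) (by positivity)
  obtain ⟨l, hl, hl2⟩ := (mem_nhdsLT_iff_exists_Ioo_subset).1 hev
  refine ⟨sstar - l, sub_pos.2 hl, ?_⟩
  intro s hs hsl hss ξ hξ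
  have hsum : Φ s (R + 1) + Ψ s (R + 1) < h * h := hl2 ⟨by linarith, hss⟩
  have hw := hWV s hs hss
  have n1 := (hw.b1 (R + 1) (by linarith)).1
  have n2 := (hw.b2 (R + 1) (by linarith)).1
  have j1 := k1 s hs hss.le _ _ _ _ _ _ hw R ξ h (h * h) hξ.1 hξ.2 hh0 hh1 (by linarith)
    (by linarith)
  have j2 := k2 s hs hss.le _ _ _ _ _ _ hw.symm R ξ h (h * h) hξ.1 hξ.2 hh0 hh1 (by linarith)
    (by linarith)
  rw [mul_div_cancel_right₀ _ hh0.ne'] at j1 j2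
  have m1 := mul_pos hC1 hh0
  have m2 := mul_pos hC2 hh0
  constructor <;> linarith

end
end

section
/- Assume (A1)–(A3) hold and bc − ad > 0. For s ∈ [0,s*), let (φ_s, ψ_s) be the unique strictly increasing solution of the semi-wave system (1.5). If 0 ≤ s1 < s2 < s*, then φ_{s1}(ξ) > φ_{s2}(ξ) and ψ_{s1}(ξ) > ψ_{s2}(ξ) for all ξ ∈ (0,+∞). -/
open Set Filter Topology

noncomputable section

lemma aux_second {h : ℝ → ℝ} {x : ℝ} (hm : IsLocalMin h x) (hc : ContinuousAt h x) :
    0 ≤ deriv (deriv h) x := by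
  by_contra hneg
  push Not at hneg
  have hM := isLocalMax_of_deriv_deriv_neg hneg hm.deriv_eq_zero hc
  have he : h =ᶠ[𝓝 x] fun _ => h x := by
    filter_upwards [hm, hM] with y h1 h2
    exact le_antisymm h2 h1
  have := he.deriv.deriv_eq
  simp at this
  linarith

lemma aux_diff {f : ℝ → ℝ} (hf : ContDiffOn ℝ 2 f (Ici 0)) {x : ℝ} (hx : 0 < x) :
    DifferentiableAt ℝ f x ∧ DifferentiableAt ℝ (deriv f) x := by
  have h := hf.contDiffAt (Ici_mem_nhds hx)
  refine ⟨h.differentiableAt (by norm_num), ?_⟩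
  have h2 : ContDiffOn ℝ 2 f (Ioi 0) := hf.mono Ioi_subset_Ici_self
  have h3 := ((contDiffOn_succ_iff_deriv_of_isOpen (n := 1) isOpen_Ioi).1
    (by simpa [one_add_one_eq_two] using h2)).2.2
  exact (h3.differentiableOn (by norm_num)).differentiableAt (Ioi_mem_nhds hx)

lemma aux_nonneg {f : ℝ → ℝ} (hf : StrictMonoOn f (Ici 0)) {x : ℝ} (hx : 0 < x) :
    0 ≤ deriv f x := by
  rw [← derivWithin_of_mem_nhds (Ici_mem_nhds hx)]
  exact hf.monotoneOn.derivWithin_nonneg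

lemma aux_comp {D s1 s2 A B k τ x p q Ff Fg : ℝ} {f g : ℝ → ℝ}
    (hD : 0 < D) (hx : 0 < x) (hτ : 0 ≤ τ)
    (hf : ContDiffOn ℝ 2 f (Ici 0)) (hg : ContDiffOn ℝ 2 g (Ici 0))
    (of : D * deriv (deriv f) (x + τ) - s1 * deriv f (x + τ) - A * f (x + τ) + B * p - Ff = 0)
    (og : D * deriv (deriv g) x - s2 * deriv g x - A * g x + B * q - Fg = 0)
    (hle : ∀ y, 0 ≤ y → g y ≤ k * f (y + τ)) (he : g x = k * f (x + τ)) :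
    B * (k * p - q) + (s2 - s1) * deriv g x ≤ k * Ff - Fg := by
  have dg := fun {y : ℝ} (hy : 0 < y) => aux_diff hg hy
  have df : ∀ {y : ℝ}, 0 < y → DifferentiableAt ℝ (fun z => f (z + τ)) y := by
    intro y hy
    have := (aux_diff hf (x := y + τ) (by linarith)).1
    exact DifferentiableAt.comp y this (by fun_prop)
  have df' : DifferentiableAt ℝ (fun z => deriv f (z + τ)) x := by
    have := (aux_diff hf (x := x + τ) (by linarith)).2
    exact DifferentiableAt.comp (g := deriv f) (f := fun z => z + τ) x this (by fun_prop)
  set h : ℝ → ℝ := fun y => k * f (y + τ) - g y with hh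
  have hmin : IsLocalMin h x := by
    filter_upwards [Ioi_mem_nhds hx] with y hy
    have := hle y (le_of_lt hy)
    simp only [hh]; linarith
  have d1 : ∀ y, 0 < y → deriv h y = k * deriv f (y + τ) - deriv g y := by
    intro y hy
    rw [hh, deriv_fun_sub ((df hy).const_mul k) (dg hy).1, deriv_const_mul _ (df hy),
      deriv_comp_add_const]
  have d2 : deriv (deriv h) x = k * deriv (deriv f) (x + τ) - deriv (deriv g) x := by
    have : deriv h =ᶠ[𝓝 x] fun y => k * deriv f (y + τ) - deriv g y := by
      filter_upwards [Ioi_mem_nhds hx] with y hy using d1 y hy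
    rw [this.deriv_eq, deriv_fun_sub (df'.const_mul k) (dg hx).2, deriv_const_mul _ df',
      deriv_comp_add_const]
  have e1 := hmin.deriv_eq_zero
  rw [d1 x hx] at e1
  have e2 := aux_second hmin (((df hx).const_mul k).sub (dg hx).1).continuousAt
  rw [d2] at e2
  have e3 := mul_nonneg hD.le e2
  have e4 : Ff = D * deriv (deriv f) (x + τ) - s1 * deriv f (x + τ) - A * f (x + τ) + B * p := by
    linarith
  have e5 : Fg = D * deriv (deriv g) x - s2 * deriv g x - A * g x + B * q := by linarith
  have e6 : deriv g x = k * deriv f (x + τ) := by linarith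
  rw [e4, e5, he, e6]
  rw [e6] at *
  nlinarith

lemma aux_ratio {F : ℝ → ℝ} (hF : StrictMonoOn (fun z => F z / z) (Ioi 0)) {k z : ℝ}
    (hk : 1 < k) (hz : 0 < z) : k * F z < F (k * z) := by
  have hkz : z < k * z := by nlinarith
  have := hF (show z ∈ Ioi 0 from hz) (show k * z ∈ Ioi 0 from hz.trans hkz) hkz
  simp only at this
  rw [div_lt_div_iff₀ hz (hz.trans hkz)] at this
  nlinarith

lemma aux_cont {f : ℝ → ℝ} (hf : ContDiffOn ℝ 2 f (Ici 0)) {τ : ℝ} (hτ : 0 ≤ τ) :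
    ContinuousOn (fun y => f (y + τ)) (Ici 0) := by
  refine hf.continuousOn.comp (by fun_prop) ?_
  intro y hy
  simp only [mem_Ici] at *
  linarith

lemma aux_pos {f : ℝ → ℝ} (hf : StrictMonoOn f (Ici 0)) (h0 : f 0 = 0) {x : ℝ} (hx : 0 < x) :
    0 < f x := by
  have := hf (show (0:ℝ) ∈ Ici 0 by simp) (show x ∈ Ici 0 from hx.le) hx
  linarith

lemma aux_lt {f : ℝ → ℝ} {l : ℝ} (hf : StrictMonoOn f (Ici 0)) (hl : Tendsto f atTop (𝓝 l))
    {x : ℝ} (hx : 0 < x) : f x < l := by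
  have h1 := hf (show x ∈ Ici 0 from hx.le) (show x + 1 ∈ Ici 0 by simp; linarith)
    (by linarith : x < x + 1)
  have h2 : f (x + 1) ≤ l := by
    refine ge_of_tendsto hl ?_
    filter_upwards [eventually_ge_atTop (x + 1)] with y hy
    exact hf.monotoneOn (show x + 1 ∈ Ici 0 by simp; linarith)
      (show y ∈ Ici 0 by simp; linarith) hy
  linarith

/-- Strict sub-equilibria cannot be equilibria. -/
lemma aux_eq {a b c d u v us vs : ℝ} {F G : ℝ → ℝ} (hb : 0 < b) (hc : 0 < c)
    (hA : CondA F G) (hE : IsEquilibrium a b c d F G us vs) (hu : 0 < u) (hv : 0 < v)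
    (hus : u < us) (hvs : v < vs)
    (e1 : - a * u + b * v - F u = 0) (e2 : c * u - d * v - G v = 0) : False := by
  obtain ⟨-, -, E1, E2⟩ := hE
  rcases le_total (vs / v) (us / u) with h | h
  · have hk : 1 < us / u := (one_lt_div hu).2 hus
    have h1 := aux_ratio hA.ratioF hk hu
    set k := us / u with hkd
    have h2 : us = k * u := by rw [hkd]; field_simp
    have h3 : vs ≤ k * v := (div_le_iff₀ hv).1 h
    rw [← h2] at h1
    have h4 : F u = -a * u + b * v := by linarith
    rw [h4] at h1
    have h5 := mul_le_mul_of_nonneg_left h3 hb.le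
    have h6 : a * us = a * (k * u) := by rw [← h2]
    nlinarith
  · have hk : 1 < vs / v := (one_lt_div hv).2 hvs
    have h1 := aux_ratio hA.ratioG hk hv
    set k := vs / v with hkd
    have h2 : vs = k * v := by rw [hkd]; field_simp
    have h3 : us ≤ k * u := (div_le_iff₀ hu).1 h
    rw [← h2] at h1
    have h4 : G v = c * u - d * v := by linarith
    rw [h4] at h1
    have h5 := mul_le_mul_of_nonneg_left h3 hc.le
    have h6 : d * vs = d * (k * v) := by rw [← h2]
    nlinarith

lemma aux_shift {d1 d2 a b c d : ℝ}
    (hd1 : 0 < d1) (hd2 : 0 < d2) (hb : 0 < b) (hc : 0 < c)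
    {F G : ℝ → ℝ} (hA : CondA F G)
    {ustar vstar : ℝ} (hEq : IsEquilibrium a b c d F G ustar vstar)
    {s1 s2 : ℝ} (h12 : s1 < s2)
    {φ1 ψ1 φ2 ψ2 : ℝ → ℝ}
    (hsw1 : IncSemiWave d1 d2 a b c d F G ustar vstar s1 φ1 ψ1)
    (hsw2 : IncSemiWave d1 d2 a b c d F G ustar vstar s2 φ2 ψ2)
    {τ : ℝ} (hτ : 0 < τ) : ∀ y, 0 ≤ y → φ2 y ≤ φ1 (y + τ) ∧ ψ2 y ≤ ψ1 (y + τ) := by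
  obtain ⟨w1, mφ1, mψ1⟩ := hsw1
  obtain ⟨w2, mφ2, mψ2⟩ := hsw2
  have pφ : ∀ y, 0 ≤ y → 0 < φ1 (y + τ) := fun y hy => aux_pos mφ1 w1.zeroφ (by linarith)
  have pψ : ∀ y, 0 ≤ y → 0 < ψ1 (y + τ) := fun y hy => aux_pos mψ1 w1.zeroψ (by linarith)
  set m : ℝ → ℝ := fun y => max (φ2 y / φ1 (y + τ)) (ψ2 y / ψ1 (y + τ)) with hm
  have key : ∀ y, 0 ≤ y → m y ≤ 1 := by
    by_contra hcon
    push Not at hcon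
    obtain ⟨y0, hy0, hgt⟩ := hcon
    have mc : ContinuousOn m (Ici 0) := by
      refine ContinuousOn.sup ?_ ?_
      · exact w2.regφ.continuousOn.div (aux_cont w1.regφ hτ.le) (fun y hy => (pφ y hy).ne')
      · exact w2.regψ.continuousOn.div (aux_cont w1.regψ hτ.le) (fun y hy => (pψ y hy).ne')
    have sh : Tendsto (fun y : ℝ => y + τ) atTop atTop := tendsto_atTop_add_const_right _ _ tendsto_id
    have ml : Tendsto m atTop (𝓝 1) := by
      have t1 := w2.limφ.div (w1.limφ.comp sh) hEq.1.ne'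
      have t2 := w2.limψ.div (w1.limψ.comp sh) hEq.2.1.ne'
      have := t1.max t2
      rw [div_self hEq.1.ne', div_self hEq.2.1.ne', max_self] at this
      exact this
    obtain ⟨x, hx0, hxm⟩ := mc.exists_isMaxOn' isClosed_Ici (x₀ := y0) hy0 (by
      rw [cocompact_eq_atBot_atTop, inf_sup_right, eventually_sup]
      constructor
      · rw [eventually_inf_principal]
        filter_upwards [eventually_lt_atBot (0:ℝ)] with y hy hy'
        exact absurd hy' (by simpa using hy)
      · rw [eventually_inf_principal]
        filter_upwards [ml.eventually_lt_const hgt] with y hy _ using hy.le)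
    have hk : 1 < m x := lt_of_lt_of_le hgt (hxm hy0)
    have hxpos : 0 < x := by
      rcases eq_or_lt_of_le (show (0:ℝ) ≤ x from hx0) with h | h
      · exfalso
        rw [← h] at hk
        simp [hm, w2.zeroφ, w2.zeroψ] at hk
        linarith
      · exact h
    have l1 : ∀ y, 0 ≤ y → φ2 y ≤ m x * φ1 (y + τ) := fun y hy =>
      (div_le_iff₀ (pφ y hy)).1 ((le_max_left _ _).trans (hxm (show y ∈ Ici 0 from hy)))
    have l2 : ∀ y, 0 ≤ y → ψ2 y ≤ m x * ψ1 (y + τ) := fun y hy =>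
      (div_le_iff₀ (pψ y hy)).1 ((le_max_right _ _).trans (hxm (show y ∈ Ici 0 from hy)))
    have o1 := w1.odeφ (x + τ) (by linarith)
    have o2 := w2.odeφ x hxpos
    have o3 := w1.odeψ (x + τ) (by linarith)
    have o4 := w2.odeψ x hxpos
    have n1 := mul_nonneg (sub_nonneg.2 h12.le) (aux_nonneg mφ2 hxpos)
    have n2 := mul_nonneg (sub_nonneg.2 h12.le) (aux_nonneg mψ2 hxpos)
    have n3 := mul_nonneg hb.le (sub_nonneg.2 (l2 x hx0))
    have n4 := mul_nonneg hc.le (sub_nonneg.2 (l1 x hx0))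
    rcases max_choice (φ2 x / φ1 (x + τ)) (ψ2 x / ψ1 (x + τ)) with h | h
    · have he : φ2 x = m x * φ1 (x + τ) := by
        rw [← div_eq_iff (pφ x hx0).ne']; exact h.symm
      have := aux_comp hd1 hxpos hτ.le w1.regφ w2.regφ o1 o2 l1 he
      have r := aux_ratio hA.ratioF hk (pφ x hx0)
      rw [← he] at r
      linarith
    · have he : ψ2 x = m x * ψ1 (x + τ) := by
        rw [← div_eq_iff (pψ x hx0).ne']; exact h.symm
      have := aux_comp (A := d) (B := c) (p := φ1 (x + τ)) (q := φ2 x)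
        (Ff := G (ψ1 (x + τ))) (Fg := G (ψ2 x)) hd2 hxpos hτ.le w1.regψ w2.regψ
        (s1 := s1) (s2 := s2) (by linarith) (by linarith) l2 he
      have r := aux_ratio hA.ratioG hk (pψ x hx0)
      rw [← he] at r
      linarith
  intro y hy
  constructor
  · exact (div_le_one (pφ y hy)).1 ((le_max_left _ _).trans (key y hy))
  · exact (div_le_one (pψ y hy)).1 ((le_max_right _ _).trans (key y hy))

lemma aux_lim {f : ℝ → ℝ} (hf : ContDiffOn ℝ 2 f (Ici 0)) {y A : ℝ} (hy : 0 < y)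
    (h : ∀ τ, 0 < τ → A ≤ f (y + τ)) : A ≤ f y := by
  have hc : ContinuousAt f y := (aux_diff hf hy).1.continuousAt
  have ht : Tendsto (fun τ => f (y + τ)) (𝓝[>] 0) (𝓝 (f y)) := by
    have h2 : Tendsto (fun τ : ℝ => y + τ) (𝓝[>] 0) (𝓝 y) := by
      have : Tendsto (fun τ : ℝ => y + τ) (𝓝 0) (𝓝 (y + 0)) := by
        exact (by fun_prop : Continuous fun τ : ℝ => y + τ).tendsto 0
      rw [add_zero] at this
      exact this.mono_left nhdsWithin_le_nhds
    exact hc.tendsto.comp h2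
  exact ge_of_tendsto ht (by filter_upwards [self_mem_nhdsWithin] with τ hτ using h τ hτ)

/-- At a contact point with `k = 1`, the first two derivatives of the slower wave vanish. -/
lemma aux_touch {D s1 s2 A B x p q Fg : ℝ} {f g : ℝ → ℝ}
    (hD : 0 < D) (hB : 0 < B) (h12 : s1 < s2) (hx : 0 < x)
    (hf : ContDiffOn ℝ 2 f (Ici 0)) (hg : ContDiffOn ℝ 2 g (Ici 0))
    (mg : StrictMonoOn g (Ici 0)) (hqp : q ≤ p)
    (of : D * deriv (deriv f) x - s1 * deriv f x - A * f x + B * p - Fg = 0)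
    (og : D * deriv (deriv g) x - s2 * deriv g x - A * g x + B * q - Fg = 0)
    (hle : ∀ y, 0 ≤ y → g y ≤ f y) (he : g x = f x) :
    p = q ∧ - A * g x + B * q - Fg = 0 := by
  have h := aux_comp (k := 1) (τ := 0) hD hx le_rfl hf hg (by simpa using of) og
    (by simpa using hle) (by simpa using he)
  have h0 := aux_nonneg mg hx
  have n1 := mul_nonneg (sub_nonneg.2 h12.le) h0
  have n2 := mul_nonneg hB.le (sub_nonneg.2 hqp)
  have z1 : (s2 - s1) * deriv g x = 0 := by linarith
  have z2 : B * (p - q) = 0 := by linarith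
  have z3 : deriv g x = 0 := by
    rcases mul_eq_zero.1 z1 with h | h
    · linarith
    · exact h
  have z4 : p = q := by
    rcases mul_eq_zero.1 z2 with h | h <;> linarith
  have z5 : deriv (deriv g) x = 0 := by
    have : IsLocalMin (deriv g) x := by
      filter_upwards [Ioi_mem_nhds hx] with y hy
      rw [z3]; exact aux_nonneg mg hy
    exact this.deriv_eq_zero
  refine ⟨z4, ?_⟩
  rw [z3, z5] at og
  linarith

theorem statement8
    (d1 d2 a b c d : ℝ)
    (hd1 : 0 < d1) (hd2 : 0 < d2) (ha : 0 < a) (hb : 0 < b) (hc : 0 < c) (hd : 0 < d)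
    (hbcad : 0 < b * c - a * d)
    (F G : ℝ → ℝ) (hA : CondA F G)
    (ustar vstar : ℝ) (hEq : IsEquilibrium a b c d F G ustar vstar)
    (sstar : ℝ) (hcrit : IsCriticalSpeed d1 d2 a b c d F G ustar vstar sstar)
    (s1 s2 : ℝ) (hs1 : 0 ≤ s1) (h12 : s1 < s2) (hs2 : s2 < sstar)
    (φ1 ψ1 φ2 ψ2 : ℝ → ℝ)
    (hsw1 : IncSemiWave d1 d2 a b c d F G ustar vstar s1 φ1 ψ1)
    (hsw2 : IncSemiWave d1 d2 a b c d F G ustar vstar s2 φ2 ψ2) :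
    ∀ ξ > (0:ℝ), φ2 ξ < φ1 ξ ∧ ψ2 ξ < ψ1 ξ := by
  have hsh := fun {τ : ℝ} (hτ : 0 < τ) =>
    aux_shift hd1 hd2 hb hc hA hEq h12 hsw1 hsw2 hτ
  obtain ⟨w1, mφ1, mψ1⟩ := hsw1
  obtain ⟨w2, mφ2, mψ2⟩ := hsw2
  have l1 : ∀ y, 0 ≤ y → φ2 y ≤ φ1 y := by
    intro y hy
    rcases eq_or_lt_of_le hy with h | h
    · rw [← h, w1.zeroφ, w2.zeroφ]
    · exact aux_lim w1.regφ h fun τ hτ => (hsh hτ y hy).1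
  have l2 : ∀ y, 0 ≤ y → ψ2 y ≤ ψ1 y := by
    intro y hy
    rcases eq_or_lt_of_le hy with h | h
    · rw [← h, w1.zeroψ, w2.zeroψ]
    · exact aux_lim w1.regψ h fun τ hτ => (hsh hτ y hy).2
  intro x hx
  have T1 : φ2 x = φ1 x → ψ1 x = ψ2 x ∧ - a * φ2 x + b * ψ2 x - F (φ2 x) = 0 := by
    intro he
    have o1 := w1.odeφ x hx
    rw [← congrArg F he] at o1
    exact aux_touch hd1 hb h12 hx w1.regφ w2.regφ mφ2 (l2 x hx.le) o1 (w2.odeφ x hx) l1 he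
  have T2 : ψ2 x = ψ1 x → φ1 x = φ2 x ∧ - d * ψ2 x + c * φ2 x - G (ψ2 x) = 0 := by
    intro he
    have o1 := w1.odeψ x hx
    have o2 := w2.odeψ x hx
    rw [← congrArg G he] at o1
    exact aux_touch (s1 := s1) (s2 := s2) hd2 hc h12 hx w1.regψ w2.regψ mψ2 (l1 x hx.le)
      (by linarith) (by linarith) l2 he
  have fin : φ2 x = φ1 x → ψ2 x = ψ1 x → False := by
    intro e1 e2
    exact aux_eq hb hc hA hEq (aux_pos mφ2 w2.zeroφ hx) (aux_pos mψ2 w2.zeroψ hx)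
      (aux_lt mφ2 w2.limφ hx) (aux_lt mψ2 w2.limψ hx) (T1 e1).2 (by linarith [(T2 e2).2])
  constructor
  · exact lt_of_le_of_ne (l1 x hx.le) fun e => fin e (T1 e).1.symm
  · exact lt_of_le_of_ne (l2 x hx.le) fun e => fin (T2 e).1.symm e

end
end

section
/- Let d1, d2, a, b, c, d be positive reals with bc − ad > 0, and for s ≥ 0 define the quartic polynomial P_s(λ) := (d1·λ² − s·λ − a)(d2·λ² − s·λ − d) − bc. Then: (i) there exists s0 > 0 such that for every s ≥ s0, all four complex roots of P_s are real; (ii) P_0 has a pair of conjugate purely imaginary (nonreal) roots, i.e. there exists β > 0 with P_0(iβ) = 0 in ℂ; consequently s* := inf{ s0 > 0 : for all s ≥ s0 every complex root of P_s is real } is a well-defined real number, and s* > 0. -/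
open Set Filter Topology

noncomputable section

theorem ivt9 (f : ℝ → ℝ) (hf : Continuous f) (x y : ℝ) (hxy : x < y) (h : f x * f y < 0) :
    ∃ r, x < r ∧ r < y ∧ f r = 0 := by
  rcases lt_or_ge (f x) 0 with h1 | h1
  · have h2 : 0 < f y := by
      by_contra hh
      nlinarith
    obtain ⟨r, hr, h0⟩ := intermediate_value_Ioo hxy.le hf.continuousOn (show (0:ℝ) ∈ Ioo (f x) (f y) from ⟨h1, h2⟩)
    exact ⟨r, hr.1, hr.2, h0⟩
  · have h2 : f y < 0 := by
      by_contra hh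
      nlinarith
    have h3 : 0 < f x := by
      rcases h1.lt_or_eq with h4 | h4
      · exact h4
      · rw [← h4] at h
        simp at h
    obtain ⟨r, hr, h0⟩ := intermediate_value_Ioo' hxy.le hf.continuousOn (show (0:ℝ) ∈ Ioo (f y) (f x) from ⟨h2, h3⟩)
    exact ⟨r, hr.1, hr.2, h0⟩

theorem quad9 (k s e R : ℝ) (h1 : 1 ≤ R) (he : 0 ≤ e) (h : s + e < k * R) :
    e < k * R ^ 2 - s * R := by
  nlinarith [mul_nonneg (sub_nonneg.2 h1) (show 0 ≤ k * R - s by linarith)]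

theorem roots9 (d1 d2 a b c d s : ℝ)
    (hd1 : 0 < d1) (hd2 : 0 < d2) (ha : 0 < a) (hb : 0 < b) (hc : 0 < c) (hd : 0 < d)
    (hbcad : 0 < b * c - a * d) (hs : 1 ≤ s) (hs2 : b * c * (d1 + d2) ^ 4 / (d1 * d2) ≤ s) :
    ∃ r1 r2 r3 r4 : ℝ, r1 < r2 ∧ r2 < r3 ∧ r3 < r4 ∧ ∀ r ∈ ({r1, r2, r3, r4} : Finset ℝ),
      (d1 * r ^ 2 - s * r - a) * (d2 * r ^ 2 - s * r - d) - b * c = 0 := by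
  set f : ℝ → ℝ := fun r => (d1 * r ^ 2 - s * r - a) * (d2 * r ^ 2 - s * r - d) - b * c with hf
  have hfc : Continuous f := by
    rw [hf]
    fun_prop
  have big : ∀ u v : ℝ, b < u → c < v → 0 < u * v - b * c := by
    intro u v hu hv
    nlinarith
  -- left point
  obtain ⟨L, hL, hfL⟩ : ∃ L : ℝ, L < 0 ∧ 0 < f L := by
    set R := 1 + (a + b) / d1 + (c + d) / d2 with hR
    have e1 : 0 < (a + b) / d1 := by positivity
    have e2 : 0 < (c + d) / d2 := by positivity
    have e3 : d1 * ((a + b) / d1) = a + b := by field_simp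
    have e4 : d2 * ((c + d) / d2) = c + d := by field_simp
    have e5 : R ≤ R ^ 2 := by nlinarith
    have e6 : a + b < d1 * R := by rw [hR]; nlinarith
    have e7 : c + d < d2 * R := by rw [hR]; nlinarith
    refine ⟨-R, by linarith, ?_⟩
    apply big
    · nlinarith
    · nlinarith
  have h0 : f 0 < 0 := by
    simp only [hf]; nlinarith
  have hM : 0 < s / (d1 + d2) := by positivity
  have k1 : d1 * (s / (d1 + d2)) ^ 2 - s * (s / (d1 + d2)) = - (s ^ 2 * d2 / (d1 + d2) ^ 2) := by
    field_simp; ring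
  have k2 : d2 * (s / (d1 + d2)) ^ 2 - s * (s / (d1 + d2)) = - (s ^ 2 * d1 / (d1 + d2) ^ 2) := by
    field_simp; ring
  have p1 : 0 < s ^ 2 * d2 / (d1 + d2) ^ 2 := by positivity
  have p2 : 0 < s ^ 2 * d1 / (d1 + d2) ^ 2 := by positivity
  have hfM : 0 < f (s / (d1 + d2)) := by
    simp only [hf]
    rw [k1, k2]
    have h4 : s ≤ s ^ 4 := le_self_pow₀ hs (by norm_num)
    have h5 : b * c ≤ (s ^ 2 * d2 / (d1 + d2) ^ 2) * (s ^ 2 * d1 / (d1 + d2) ^ 2) := by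
      have : (s ^ 2 * d2 / (d1 + d2) ^ 2) * (s ^ 2 * d1 / (d1 + d2) ^ 2)
        = s ^ 4 * (d1 * d2) / (d1 + d2) ^ 4 := by field_simp
      rw [this, le_div_iff₀ (by positivity)]
      have := hs2.trans h4
      rwa [div_le_iff₀ (by positivity)] at this
    nlinarith [mul_pos p1 hd, mul_pos p2 ha, mul_pos ha hd]
  obtain ⟨R, hR, hR1, hR2⟩ : ∃ R : ℝ, s / (d1 + d2) < R ∧ b < d1 * R ^ 2 - s * R - a
      ∧ c < d2 * R ^ 2 - s * R - d := by
    set R := 1 + (s + a + b) / d1 + (s + c + d) / d2 with hR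
    have e1 : 0 < (s + a + b) / d1 := by positivity
    have e2 : 0 < (s + c + d) / d2 := by positivity
    have e3 : d1 * ((s + a + b) / d1) = s + a + b := by field_simp
    have e4 : d2 * ((s + c + d) / d2) = s + c + d := by field_simp
    have e6 : s + a + b < d1 * R := by rw [hR]; nlinarith
    have e7 : s + c + d < d2 * R := by rw [hR]; nlinarith
    have e8 : 1 ≤ R := by linarith
    refine ⟨R, ?_, ?_, ?_⟩
    · rw [div_lt_iff₀ (by positivity)]
      nlinarith
    · linarith [quad9 d1 s (a + b) R e8 (by linarith) (by linarith)]
    · linarith [quad9 d2 s (c + d) R e8 (by linarith) (by linarith)]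
  obtain ⟨l, hl1, hl2, hl⟩ := ivt9 (fun r => d1 * r ^ 2 - s * r - a) (by fun_prop) _ _ hR
    (by
      rw [k1]
      apply mul_neg_of_neg_of_pos <;> linarith)
  have hfl : f l < 0 := by
    simp only [hf]
    rw [hl]
    nlinarith
  have hfR : 0 < f R := big _ _ hR1 hR2
  obtain ⟨r1, _, a1, z1⟩ := ivt9 f hfc _ _ hL (mul_neg_of_pos_of_neg hfL h0)
  obtain ⟨r2, a2, a3, z2⟩ := ivt9 f hfc _ _ hM (mul_neg_of_neg_of_pos h0 hfM)
  obtain ⟨r3, a4, a5, z3⟩ := ivt9 f hfc _ _ hl1 (mul_neg_of_pos_of_neg hfM hfl)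
  obtain ⟨r4, a6, a7, z4⟩ := ivt9 f hfc _ _ hl2 (mul_neg_of_neg_of_pos hfl hfR)
  refine ⟨r1, r2, r3, r4, by linarith, by linarith, by linarith, ?_⟩
  intro r hr
  simp only [Finset.mem_insert, Finset.mem_singleton] at hr
  rcases hr with rfl | rfl | rfl | rfl <;> assumption

open Polynomial in
/-- The quartic as a complex polynomial. -/
def poly9 (d1 d2 a b c d s : ℝ) : Polynomial ℂ :=
  C ((d1 : ℂ) * d2) * X ^ 4 + C (-((s : ℂ) * (d1 + d2))) * X ^ 3
    + C ((s : ℂ) ^ 2 - a * d2 - d * d1) * X ^ 2 + C ((s : ℂ) * (a + d)) * X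
    + C ((a : ℂ) * d - b * c)

theorem poly9_eval (d1 d2 a b c d s : ℝ) (z : ℂ) : (poly9 d1 d2 a b c d s).eval z =
      ((d1 : ℂ) * z ^ 2 - (s : ℂ) * z - (a : ℂ)) *
        ((d2 : ℂ) * z ^ 2 - (s : ℂ) * z - (d : ℂ)) - ((b : ℂ) * (c : ℂ)) := by
  simp only [poly9, Polynomial.eval_add, Polynomial.eval_mul, Polynomial.eval_C,
    Polynomial.eval_pow, Polynomial.eval_X]
  ring

theorem poly9_deg (d1 d2 a b c d s : ℝ) (hd1 : 0 < d1) (hd2 : 0 < d2) :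
    (poly9 d1 d2 a b c d s).natDegree = 4 := by
  have : (d1 : ℂ) * d2 ≠ 0 := by
    exact_mod_cast (mul_pos hd1 hd2).ne'
  unfold poly9
  compute_degree!
  exact ⟨hd1.ne', hd2.ne'⟩

theorem poly9_lead (d1 d2 a b c d s : ℝ) (hd1 : 0 < d1) (hd2 : 0 < d2) :
    (poly9 d1 d2 a b c d s).leadingCoeff = (d1 : ℂ) * d2 := by
  have : (d1 : ℂ) * d2 ≠ 0 := by
    exact_mod_cast (mul_pos hd1 hd2).ne'
  rw [Polynomial.leadingCoeff, poly9_deg d1 d2 a b c d s hd1 hd2]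
  unfold poly9
  simp only [Polynomial.coeff_add, Polynomial.coeff_C_mul, Polynomial.coeff_X_pow,
    Polynomial.coeff_X, Polynomial.coeff_C]
  norm_num

theorem real9 (d1 d2 a b c d s : ℝ)
    (hd1 : 0 < d1) (hd2 : 0 < d2) (ha : 0 < a) (hb : 0 < b) (hc : 0 < c) (hd : 0 < d)
    (hbcad : 0 < b * c - a * d) (hs : 1 ≤ s) (hs2 : b * c * (d1 + d2) ^ 4 / (d1 * d2) ≤ s)
    (z : ℂ) (hz : ((d1 : ℂ) * z ^ 2 - (s : ℂ) * z - (a : ℂ)) *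
        ((d2 : ℂ) * z ^ 2 - (s : ℂ) * z - (d : ℂ)) - ((b : ℂ) * (c : ℂ)) = 0) : z.im = 0 := by
  obtain ⟨r1, r2, r3, r4, h12, h23, h34, hr⟩ :=
    roots9 d1 d2 a b c d s hd1 hd2 ha hb hc hd hbcad hs hs2
  by_contra hzi
  have hdeg := poly9_deg d1 d2 a b c d s hd1 hd2
  classical
  set S : Finset ℂ := insert z (({r1, r2, r3, r4} : Finset ℝ).image Complex.ofReal) with hS
  have hcard : S.card = 5 := by
    rw [hS, Finset.card_insert_of_notMem, Finset.card_image_of_injective _ Complex.ofReal_injective]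
    · rw [Finset.card_insert_of_notMem, Finset.card_insert_of_notMem,
        Finset.card_insert_of_notMem, Finset.card_singleton]
      · simp; linarith
      · simp; constructor <;> linarith
      · simp; refine ⟨?_, ?_, ?_⟩ <;> linarith
    · intro h
      rw [Finset.mem_image] at h
      obtain ⟨r, _, rfl⟩ := h
      simp at hzi
  have h0 : poly9 d1 d2 a b c d s = 0 := by
    apply Polynomial.eq_zero_of_natDegree_lt_card_of_eval_eq_zero' _ S
    · intro w hw
      rw [hS, Finset.mem_insert, Finset.mem_image] at hw
      rw [poly9_eval]
      rcases hw with rfl | ⟨r, hr', rfl⟩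
      · exact hz
      · exact_mod_cast hr r hr'
    · omega
  rw [h0] at hdeg
  simp at hdeg

theorem cons9 (S : Multiset ℂ) (n : ℕ) (h : S.card = n + 1) :
    ∃ z T, z ::ₘ T = S ∧ Multiset.card T = n := by
  have : 0 < S.card := by omega
  obtain ⟨z, hz⟩ := Multiset.card_pos_iff_exists_mem.1 this
  obtain ⟨T, rfl⟩ := Multiset.exists_cons_of_mem hz
  exact ⟨z, T, rfl, by simpa using h⟩

theorem neg9 (d1 d2 a b c d s : ℝ) (hd1 : 0 < d1) (hd2 : 0 < d2)
    (h : ∀ z : ℂ, ((d1 : ℂ) * z ^ 2 - (s : ℂ) * z - (a : ℂ)) *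
        ((d2 : ℂ) * z ^ 2 - (s : ℂ) * z - (d : ℂ)) - ((b : ℂ) * (c : ℂ)) = 0 → z.im = 0) :
    0 ≤ (s * (a + d)) ^ 2 - 2 * (s ^ 2 - a * d2 - d * d1) * (a * d - b * c) := by
  set p := poly9 d1 d2 a b c d s with hp
  have hsp : p.Splits := IsAlgClosed.splits p
  have hcard : p.roots.card = 4 := by
    rw [← hsp.natDegree_eq_card_roots]
    exact poly9_deg d1 d2 a b c d s hd1 hd2
  have hfac := hsp.eq_prod_roots
  have hlead : p.leadingCoeff = (d1 : ℂ) * d2 := poly9_lead d1 d2 a b c d s hd1 hd2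
  have hreal : ∀ z ∈ p.roots, ∃ r : ℝ, z = r := by
    intro z hz
    have h1 := (Polynomial.mem_roots'.1 hz).2
    rw [Polynomial.IsRoot, hp, poly9_eval] at h1
    refine ⟨z.re, ?_⟩
    apply Complex.ext
    · simp
    · simpa using h z h1
  obtain ⟨z1, t1, e1, c1⟩ := cons9 _ _ hcard
  obtain ⟨z2, t2, rfl, c2⟩ := cons9 _ _ c1
  obtain ⟨z3, t3, rfl, c3⟩ := cons9 _ _ c2
  obtain ⟨z4, rfl⟩ := Multiset.card_eq_one.1 c3
  rw [← e1] at hfac hreal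
  obtain ⟨x1, rfl⟩ := hreal z1 (by simp)
  obtain ⟨x2, rfl⟩ := hreal z2 (by simp)
  obtain ⟨x3, rfl⟩ := hreal z3 (by simp)
  obtain ⟨x4, rfl⟩ := hreal z4 (by simp)
  have key : ∀ x : ℝ, (d1 * x ^ 2 - s * x - a) * (d2 * x ^ 2 - s * x - d) - b * c
      = d1 * d2 * ((x - x1) * ((x - x2) * ((x - x3) * (x - x4)))) := by
    intro x
    have h1 := poly9_eval d1 d2 a b c d s (x : ℂ)
    rw [← hp, hfac, hlead] at h1
    simp at h1
    exact_mod_cast h1.symm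
  have q0 := key 0
  have q1 := key 1
  have q2 := key (-1)
  have q3 := key 2
  have q4 := key (-2)
  have E4 : a * d - b * c = d1 * d2 * (x1 * x2 * x3 * x4) := by linarith
  have E2 : s ^ 2 - a * d2 - d * d1
      = d1 * d2 * (x1 * x2 + x1 * x3 + x1 * x4 + x2 * x3 + x2 * x4 + x3 * x4) := by linarith
  have E3 : s * (a + d)
      = - (d1 * d2 * (x1 * x2 * x3 + x1 * x2 * x4 + x1 * x3 * x4 + x2 * x3 * x4)) := by linarith
  rw [E4, E2, E3]
  have : (-(d1 * d2 * (x1 * x2 * x3 + x1 * x2 * x4 + x1 * x3 * x4 + x2 * x3 * x4))) ^ 2 -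
      2 * (d1 * d2 * (x1 * x2 + x1 * x3 + x1 * x4 + x2 * x3 + x2 * x4 + x3 * x4)) *
        (d1 * d2 * (x1 * x2 * x3 * x4)) = (d1 * d2) ^ 2 * ((x1 * x2 * x3) ^ 2 + (x1 * x2 * x4) ^ 2
          + (x1 * x3 * x4) ^ 2 + (x2 * x3 * x4) ^ 2) := by ring
  rw [this]
  positivity

theorem statement9
    (d1 d2 a b c d : ℝ)
    (hd1 : 0 < d1) (hd2 : 0 < d2) (ha : 0 < a) (hb : 0 < b) (hc : 0 < c) (hd : 0 < d)
    (hbcad : 0 < b * c - a * d)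
    (P : ℝ → ℂ → ℂ)
    (hP : ∀ s : ℝ, ∀ z : ℂ, P s z =
      ((d1 : ℂ) * z ^ 2 - (s : ℂ) * z - (a : ℂ)) *
        ((d2 : ℂ) * z ^ 2 - (s : ℂ) * z - (d : ℂ)) - ((b : ℂ) * (c : ℂ))) :
    (∃ s0 > (0:ℝ), ∀ s ≥ s0, ∀ z : ℂ, P s z = 0 → z.im = 0) ∧
    (∃ β : ℝ, 0 < β ∧ P 0 (Complex.I * (β : ℂ)) = 0) ∧
    {s0 : ℝ | 0 < s0 ∧ ∀ s ≥ s0, ∀ z : ℂ, P s z = 0 → z.im = 0}.Nonempty ∧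
    BddBelow {s0 : ℝ | 0 < s0 ∧ ∀ s ≥ s0, ∀ z : ℂ, P s z = 0 → z.im = 0} ∧
    0 < sInf {s0 : ℝ | 0 < s0 ∧ ∀ s ≥ s0, ∀ z : ℂ, P s z = 0 → z.im = 0} := by
  have hset : ∃ s0 > (0:ℝ), ∀ s ≥ s0, ∀ z : ℂ, P s z = 0 → z.im = 0 := by
    have hpos : 0 < b * c * (d1 + d2) ^ 4 / (d1 * d2) := by positivity
    refine ⟨1 + b * c * (d1 + d2) ^ 4 / (d1 * d2), by linarith, ?_⟩
    intro s hs z hz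
    rw [hP] at hz
    exact real9 d1 d2 a b c d s hd1 hd2 ha hb hc hd hbcad (by linarith) (by linarith) z hz
  refine ⟨hset, ?_, hset, ⟨0, fun x hx => hx.1.le⟩, ?_⟩
  · set R := 1 + b / d1 + c / d2 with hR
    have e1 : 0 < b / d1 := by positivity
    have e2 : 0 < c / d2 := by positivity
    have e3 : d1 * (b / d1) = b := by field_simp
    have e4 : d2 * (c / d2) = c := by field_simp
    have e5 : R ≤ R ^ 2 := by nlinarith
    have e6 : b < d1 * R := by rw [hR]; nlinarith
    have e7 : c < d2 * R := by rw [hR]; nlinarith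
    have e8 : b < d1 * R ^ 2 + a := by nlinarith
    have e9 : c < d2 * R ^ 2 + d := by nlinarith
    obtain ⟨β, h1, _, h2⟩ := ivt9 (fun r => (d1 * r ^ 2 + a) * (d2 * r ^ 2 + d) - b * c)
      (by fun_prop) 0 R (by linarith) (by
        apply mul_neg_of_neg_of_pos
        · nlinarith
        · nlinarith)
    refine ⟨β, h1, ?_⟩
    rw [hP, mul_pow, Complex.I_sq]
    have h3 : (((d1 * β ^ 2 + a) * (d2 * β ^ 2 + d) - b * c : ℝ) : ℂ) = 0 := by
      exact_mod_cast h2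
    push_cast at h3 ⊢
    linear_combination h3
  · set D := b * c - a * d with hD
    set A := (a + d) ^ 2 + 2 * D with hA
    have hA0 : 0 < A := by positivity
    set B := (a * d2 + d * d1) * D with hB
    have hB0 : 0 < B := by positivity
    have hε : 0 < √(B / A) := Real.sqrt_pos.2 (by positivity)
    have hsq : √(B / A) ^ 2 * A = B := by
      rw [Real.sq_sqrt (by positivity)]
      field_simp
    refine hε.trans_le (le_csInf hset ?_)
    rintro s0 ⟨_, h⟩
    by_contra hlt
    have hn := neg9 d1 d2 a b c d (√(B / A)) hd1 hd2
      (fun z hz => h _ (not_le.1 hlt).le z (by rw [hP]; exact hz))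
    have : (√(B / A) * (a + d)) ^ 2 - 2 * (√(B / A) ^ 2 - a * d2 - d * d1) * (a * d - b * c)
        = √(B / A) ^ 2 * A - 2 * B := by
      rw [hA, hB, hD]
      ring
    rw [this, hsq] at hn
    linarith


end
end

section
/- Assume (A1)–(A3) hold and bc − ad > 0. Then there exists a unique pair (u*,v*) with u* > 0 and v* > 0 satisfying −a·u* + b·v* − F(u*) = 0 and c·u* − d·v* − G(v*) = 0. Moreover, (u*,v*) is globally attracting for the ODE system U' = −a·U + b·V − F(U), V' = c·U − d·V − G(V): for any initial data U(0) > 0, V(0) > 0, the solution (U(t),V(t)) exists for all t > 0 and (U(t),V(t)) → (u*,v*) as t → +∞. -/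
open Set Filter Topology

noncomputable section

lemma s19_global {E : Type*} [NormedAddCommGroup E] [NormedSpace ℝ E] [CompleteSpace E]
    (W : E → E) (K L : NNReal) (hK : LipschitzWith K W) (hL : ∀ z, ‖W z‖ ≤ L) (z0 : E) :
    ∃ γ : ℝ → E, γ 0 = z0 ∧ ∀ t, HasDerivAt γ (W (γ t)) t := by
  have loc : ∀ n : ℕ, ∃ γ : ℝ → E, γ 0 = z0 ∧
      ∀ t ∈ Ioo (-((n:ℝ)+1)) ((n:ℝ)+1), HasDerivAt γ (W (γ t)) t := by
    intro n
    have h0 : (0:ℝ) ∈ Icc (-((n:ℝ)+1)) ((n:ℝ)+1) := ⟨by linarith [n.cast_nonneg (α := ℝ)], by positivity⟩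
    have pl : IsPicardLindelof (fun _ => W) (⟨0, h0⟩ : Icc (-((n:ℝ)+1)) ((n:ℝ)+1)) z0
        (L * (n+1)) 0 L K := by
      apply IsPicardLindelof.of_time_independent
      · intro x _; exact hL x
      · exact hK.lipschitzOnWith
      · simp
    obtain ⟨γ, h1, h2⟩ := pl.exists_eq_forall_mem_Icc_hasDerivWithinAt₀
    exact ⟨γ, h1, fun t ht => (h2 t (Ioo_subset_Icc_self ht)).hasDerivAt (Icc_mem_nhds ht.1 ht.2)⟩
  choose γ h1 h2 using loc
  have agree : ∀ m n : ℕ, m ≤ n → EqOn (γ m) (γ n) (Ioo (-((m:ℝ)+1)) ((m:ℝ)+1)) := by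
    intro m n hmn
    have hmn' : (m:ℝ) ≤ n := by exact_mod_cast hmn
    have : (0:ℝ) ≤ m := m.cast_nonneg
    apply ODE_solution_unique_of_mem_Ioo (v := fun _ => W) (s := fun _ => univ) (K := K) (t₀ := 0)
    · intro t _; exact hK.lipschitzOnWith
    · constructor <;> linarith
    · intro t ht; exact ⟨h2 m t ht, trivial⟩
    · intro t ht; exact ⟨h2 n t ⟨by linarith [ht.1], by linarith [ht.2]⟩, trivial⟩
    · rw [h1, h1]
  refine ⟨fun t => γ (⌈|t|⌉₊) t, by simp [h1], fun t => ?_⟩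
  have hmem : ∀ s : ℝ, s ∈ Ioo (-((⌈|s|⌉₊:ℝ)+1)) ((⌈|s|⌉₊:ℝ)+1) := by
    intro s
    have := Nat.le_ceil |s|
    constructor <;> linarith [neg_abs_le s, le_abs_self s]
  have ev : (fun s => γ (⌈|s|⌉₊) s) =ᶠ[𝓝 t] γ (⌈|t|⌉₊) := by
    filter_upwards [Ioo_mem_nhds (hmem t).1 (hmem t).2] with s hs
    rcases le_total (⌈|s|⌉₊) (⌈|t|⌉₊) with h | h
    · exact agree _ _ h (hmem s)
    · exact (agree _ _ h hs).symm
  have := (h2 _ t (hmem t)).congr_of_eventuallyEq ev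
  exact this

lemma s19_box (Φ : ℝ × ℝ → ℝ × ℝ) (δ R : ℝ) (hδR : δ ≤ R)
    (hΦ : ContDiffOn ℝ 1 Φ (Icc δ R ×ˢ Icc δ R)) (z0 : ℝ × ℝ) :
    ∃ γ : ℝ → ℝ × ℝ, γ 0 = z0 ∧ Continuous γ ∧
      ∀ t, γ t ∈ Icc δ R ×ˢ Icc δ R → HasDerivAt γ (Φ (γ t)) t := by
  have hcv : Convex ℝ (Icc δ R ×ˢ Icc δ R) := (convex_Icc _ _).prod (convex_Icc _ _)
  have hcp : IsCompact (Icc δ R ×ˢ Icc δ R) := isCompact_Icc.prod isCompact_Icc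
  obtain ⟨K, hK⟩ := hΦ.exists_lipschitzOnWith one_ne_zero hcv hcp
  obtain ⟨L, hL⟩ := hcp.exists_bound_of_continuousOn hΦ.continuousOn
  let cl : ℝ × ℝ → ℝ × ℝ := fun z => (projIcc δ R hδR z.1, projIcc δ R hδR z.2)
  have hcl : ∀ z, cl z ∈ Icc δ R ×ˢ Icc δ R := fun z => ⟨(projIcc δ R hδR z.1).2, (projIcc δ R hδR z.2).2⟩
  have hcl1 : LipschitzWith 1 cl := by
    have h1 : LipschitzWith 1 (fun z : ℝ × ℝ => (projIcc δ R hδR z.1 : ℝ)) := by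
      simpa [Function.comp_def] using (LipschitzWith.subtype_val (Icc δ R)).comp
        ((LipschitzWith.projIcc hδR).comp (LipschitzWith.prod_fst (α := ℝ) (β := ℝ)))
    have h2 : LipschitzWith 1 (fun z : ℝ × ℝ => (projIcc δ R hδR z.2 : ℝ)) := by
      simpa [Function.comp_def] using (LipschitzWith.subtype_val (Icc δ R)).comp
        ((LipschitzWith.projIcc hδR).comp (LipschitzWith.prod_snd (α := ℝ) (β := ℝ)))
    simpa using h1.prodMk h2
  have hW : LipschitzWith K (Φ ∘ cl) := by
    intro z w
    refine (hK (hcl z) (hcl w)).trans ?_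
    gcongr
    simpa using hcl1 z w
  obtain ⟨γ, h0, h1⟩ := s19_global (Φ ∘ cl) K L.toNNReal hW
    (fun z => (hL _ (hcl z)).trans (Real.le_coe_toNNReal L)) z0
  refine ⟨γ, h0, continuous_iff_continuousAt.2 fun t => (h1 t).continuousAt, fun t ht => ?_⟩
  have e : cl (γ t) = γ t := by
    ext
    · simp [cl, projIcc_of_mem hδR ht.1]
    · simp [cl, projIcc_of_mem hδR ht.2]
  have := h1 t
  rwa [Function.comp, e] at this

lemma s19_conv {X : Type*} [TopologicalSpace X] (K : Set X) (hK : IsCompact K) (z : X)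
    (L D : X → ℝ) (hL : ContinuousOn L K) (hD : ContinuousOn D K)
    (hL0 : L z = 0)
    (hLp : ∀ p ∈ K, p ≠ z → 0 < L p) (hDp : ∀ p ∈ K, p ≠ z → 0 < D p) (hD0 : D z = 0)
    (γ : ℝ → X) (hγ : ∀ t ≥ (0:ℝ), γ t ∈ K)
    (hd : ∀ t ≥ (0:ℝ), HasDerivAt (fun s => L (γ s)) (-D (γ t)) t) :
    Tendsto γ atTop (𝓝 z) := by
  have hD1 : ∀ p ∈ K, 0 ≤ D p := by
    intro p hp
    by_cases h : p = z
    · rw [h, hD0]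
    · exact (hDp p hp h).le
  have hL1 : ∀ p ∈ K, 0 ≤ L p := by
    intro p hp
    by_cases h : p = z
    · rw [h, hL0]
    · exact (hLp p hp h).le
  have anti : AntitoneOn (fun s => L (γ s)) (Ici 0) := by
    apply antitoneOn_of_deriv_nonpos (convex_Ici 0)
    · exact HasDerivAt.continuousOn fun t ht => hd t ht
    · intro t ht; rw [interior_Ici] at ht
      exact (hd t (le_of_lt ht)).differentiableAt.differentiableWithinAt
    · intro t ht; rw [interior_Ici] at ht
      rw [(hd t (le_of_lt ht)).deriv]
      linarith [hD1 _ (hγ t (le_of_lt ht))]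
  rw [tendsto_nhds]
  intro N hN hz
  -- lower bound of L off N
  obtain ⟨m, hm, hmL⟩ : ∃ m > 0, ∀ p ∈ K, p ∉ N → m ≤ L p := by
    have hc : IsCompact (K \ N) := hK.diff hN
    rcases (K \ N).eq_empty_or_nonempty with h | h
    · refine ⟨1, one_pos, fun p hp hpn => ?_⟩
      have : p ∈ K \ N := ⟨hp, hpn⟩
      rw [h] at this; exact this.elim
    · obtain ⟨q, hq, hq2⟩ := hc.exists_isMinOn h (hL.mono sdiff_subset)
      exact ⟨L q, hLp q hq.1 (fun e => hq.2 (e ▸ hz)), fun p hp hpn => hq2 ⟨hp, hpn⟩⟩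
  obtain ⟨T, hT0, hT⟩ : ∃ T ≥ (0:ℝ), L (γ T) < m := by
    by_contra hcon
    push Not at hcon
    have hA : IsCompact (K ∩ L ⁻¹' (Ici m)) := by
      obtain ⟨C, hC, hC2⟩ := (continuousOn_iff_isClosed.1 hL) (Ici m) isClosed_Ici
      rw [inter_comm, hC2, inter_comm]
      exact hK.inter_right hC
    obtain ⟨q, hq, hq2⟩ := hA.exists_isMinOn ⟨γ 0, hγ 0 le_rfl, hcon 0 le_rfl⟩ (hD.mono inter_subset_left)
    have hη : 0 < D q := hDp q hq.1 (by rintro rfl; have := hq.2; simp only [mem_preimage, mem_Ici, hL0] at this; linarith)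
    have anti2 : AntitoneOn (fun s => L (γ s) + D q * s) (Ici 0) := by
      have hd2 : ∀ t ≥ (0:ℝ), HasDerivAt (fun s => L (γ s) + D q * s) (-D (γ t) + D q * 1) t :=
        fun t ht => (hd t ht).add ((hasDerivAt_id t).const_mul _)
      apply antitoneOn_of_deriv_nonpos (convex_Ici 0)
      · exact HasDerivAt.continuousOn fun t ht => hd2 t ht
      · intro t ht; rw [interior_Ici] at ht
        exact (hd2 t (le_of_lt ht)).differentiableAt.differentiableWithinAt
      · intro t ht; rw [interior_Ici] at ht
        rw [(hd2 t (le_of_lt ht)).deriv]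
        have : D q ≤ D (γ t) := hq2 ⟨hγ t (le_of_lt ht), hcon t (le_of_lt ht)⟩
        linarith
    have ht : 0 ≤ L (γ 0) / D q := div_nonneg (hL1 _ (hγ 0 le_rfl)) hη.le
    have := anti2 (self_mem_Ici) (show L (γ 0) / D q ∈ Ici 0 from ht) ht
    have h3 := hcon _ ht
    simp only [mul_zero, add_zero] at this
    rw [mul_div_cancel₀ _ hη.ne'] at this
    linarith
  filter_upwards [eventually_ge_atTop T] with t ht
  by_contra hn
  have ht0 : 0 ≤ t := hT0.trans ht
  have h1 := anti (show T ∈ Ici 0 from hT0) (show t ∈ Ici 0 from ht0) ht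
  have h2 := hmL _ (hγ t ht0) hn
  simp only at h1
  linarith

lemma s19_trap {X : Type*} [TopologicalSpace X] (O K : Set X) (hO : IsOpen O) (hK : IsClosed K)
    (hKO : K ⊆ O) (γ : ℝ → X) (hc : ContinuousOn γ (Ici 0)) (h0 : γ 0 ∈ O)
    (h : ∀ T ≥ (0:ℝ), (∀ t ∈ Icc 0 T, γ t ∈ O) → γ T ∈ K) :
    ∀ t ≥ (0:ℝ), γ t ∈ O := by
  by_contra hcon
  push Not at hcon
  obtain ⟨T, hT, hTn⟩ := hcon
  let B : Set ℝ := Ici 0 ∩ γ ⁻¹' Oᶜ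
  have hB : IsClosed B := hc.preimage_isClosed_of_isClosed isClosed_Ici hO.isClosed_compl
  have hBb : BddBelow B := ⟨0, fun x hx => hx.1⟩
  have hs : sInf B ∈ B := hB.csInf_mem ⟨T, hT, hTn⟩ hBb
  set s := sInf B
  have hs0 : 0 < s := lt_of_le_of_ne hs.1 (fun e => hs.2 (e ▸ h0))
  have hlt : ∀ t, 0 ≤ t → t < s → γ t ∈ O := by
    intro t h1 h2
    by_contra h3
    exact absurd (csInf_le hBb (show t ∈ B from ⟨h1, h3⟩)) (not_le.2 h2)
  have hK2 : ∀ t ∈ Ico 0 s, γ t ∈ K := fun t ht =>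
    h t ht.1 fun r hr => hlt r hr.1 (hr.2.trans_lt ht.2)
  have : γ s ∈ closure K := by
    have hcs : ContinuousWithinAt γ (Ico 0 s) s := (hc s hs.1).mono (fun x hx => hx.1)
    apply hcs.mem_closure _ hK2
    rw [closure_Ico hs0.ne]; exact ⟨hs0.le, le_rfl⟩
  rw [hK.closure_eq] at this
  exact hs.2 (hKO this)

lemma s19_h_pos (x : ℝ) (hx : 0 < x) (h1 : x ≠ 1) : 0 < x - 1 - Real.log x := by
  linarith [Real.log_lt_sub_one_of_pos hx h1]

lemma s19_h_nonneg (x : ℝ) (hx : 0 < x) : 0 ≤ x - 1 - Real.log x := by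
  linarith [Real.log_le_sub_one_of_pos hx]

lemma s19_h_bd (x M : ℝ) (hx : 0 < x) (h : x - 1 - Real.log x ≤ M) :
    x ∈ Icc (Real.exp (-(M+1))) (2*(M+1)) := by
  constructor
  · rw [← Real.le_log_iff_exp_le hx]; linarith
  · have h2 := Real.log_le_sub_one_of_pos (half_pos hx)
    rw [Real.log_div hx.ne' two_ne_zero] at h2
    linarith [Real.log_two_lt_d9]

lemma s19_sgn (p : ℝ → ℝ) (hp : StrictMonoOn p (Ioi 0)) (hp1 : p 1 = 0) (x : ℝ) (hx : 0 < x) :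
    0 ≤ (x - 1) * p x ∧ (x ≠ 1 → 0 < (x - 1) * p x) := by
  have key : x ≠ 1 → 0 < (x - 1) * p x := by
    intro h
    rcases lt_or_gt_of_ne h with h | h
    · have := hp hx (mem_Ioi.2 one_pos) h
      exact mul_pos_of_neg_of_neg (by linarith) (by linarith)
    · have := hp (mem_Ioi.2 one_pos) hx h
      exact mul_pos (by linarith) (by linarith)
  refine ⟨?_, key⟩
  by_cases h : x = 1
  · simp [h]
  · exact (key h).le

lemma s19_dyn (B C : ℝ) (hB : 0 < B) (hC : 0 < C) (p q : ℝ → ℝ)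
    (hp : StrictMonoOn p (Ioi 0)) (hq : StrictMonoOn q (Ioi 0)) (hp1 : p 1 = 0) (hq1 : q 1 = 0)
    (hpc : ContinuousOn p (Ioi 0)) (hqc : ContinuousOn q (Ioi 0))
    (x0 y0 : ℝ) (hx0 : 0 < x0) (hy0 : 0 < y0) :
    ∃ δ R : ℝ, 0 < δ ∧ δ < R ∧ ∀ x y : ℝ → ℝ, x 0 = x0 → y 0 = y0 →
      ContinuousOn x (Ici 0) → ContinuousOn y (Ici 0) →
      (∀ t ≥ (0:ℝ), x t ∈ Ioo δ R → y t ∈ Ioo δ R →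
        HasDerivAt x (B * (y t - x t) - p (x t) * x t) t ∧
        HasDerivAt y (C * (x t - y t) - q (y t) * y t) t) →
      (∀ t ≥ (0:ℝ), x t ∈ Ioo δ R ∧ y t ∈ Ioo δ R) ∧
      Tendsto x atTop (𝓝 1) ∧ Tendsto y atTop (𝓝 1) := by
  let L : ℝ × ℝ → ℝ := fun z => C * (z.1 - 1 - Real.log z.1) + B * (z.2 - 1 - Real.log z.2)
  let D : ℝ × ℝ → ℝ := fun z => B * C * ((z.1 - z.2)^2 / (z.1 * z.2))
    + C * ((z.1 - 1) * p z.1) + B * ((z.2 - 1) * q z.2)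
  set L0 := L (x0, y0) with hL0
  have hx0' := s19_h_nonneg x0 hx0
  have hy0' := s19_h_nonneg y0 hy0
  have hL0n : 0 ≤ L0 := by simp only [hL0, L]; positivity
  set M := L0 / C + L0 / B with hM
  have hMn : 0 ≤ M := by positivity
  have sub : ∀ z : ℝ × ℝ, 0 < z.1 → 0 < z.2 → L z ≤ L0 →
      z ∈ Icc (Real.exp (-(M+1))) (2*(M+1)) ×ˢ Icc (Real.exp (-(M+1))) (2*(M+1)) := by
    intro z h1 h2 h3
    have e1 := s19_h_nonneg _ h1
    have e2 := s19_h_nonneg _ h2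
    have f1 : 0 ≤ L0 / C := by positivity
    have f2 : 0 ≤ L0 / B := by positivity
    refine ⟨s19_h_bd _ _ h1 ?_, s19_h_bd _ _ h2 ?_⟩
    · have : z.1 - 1 - Real.log z.1 ≤ L0 / C := by
        rw [le_div_iff₀ hC]
        have := mul_nonneg hB.le e2
        simp only [L] at h3; linarith
      linarith
    · have : z.2 - 1 - Real.log z.2 ≤ L0 / B := by
        rw [le_div_iff₀ hB]
        have := mul_nonneg hC.le e1
        simp only [L] at h3; linarith
      linarith
  have hE := Real.exp_pos (-(M+1))
  have hE1 : Real.exp (-(M+1)) < 1 := by rw [Real.exp_lt_one_iff]; linarith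
  refine ⟨Real.exp (-(M+1)) / 2, 2*(M+1)+1, by positivity, by linarith, ?_⟩
  set δ := Real.exp (-(M+1)) with hδ
  intro x y hx hy hxc hyc hode
  have hd : ∀ t ≥ (0:ℝ), x t ∈ Ioo (δ/2) (2*(M+1)+1) → y t ∈ Ioo (δ/2) (2*(M+1)+1) →
      HasDerivAt (fun s => L (x s, y s)) (-D (x t, y t)) t := by
    intro t ht h1 h2
    obtain ⟨d1, d2⟩ := hode t ht h1 h2
    have p1 : 0 < x t := lt_trans (by positivity) h1.1
    have p2 : 0 < y t := lt_trans (by positivity) h2.1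
    have := (((d1.sub_const 1).sub (d1.log p1.ne')).const_mul C).add
      (((d2.sub_const 1).sub (d2.log p2.ne')).const_mul B)
    refine this.congr_deriv ?_
    simp only [D]
    field_simp
    ring
  have hDn : ∀ z : ℝ × ℝ, 0 < z.1 → 0 < z.2 → 0 ≤ D z := by
    intro z h1 h2
    have e1 := (s19_sgn p hp hp1 _ h1).1
    have e2 := (s19_sgn q hq hq1 _ h2).1
    simp only [D]
    positivity
  have hDp : ∀ z : ℝ × ℝ, 0 < z.1 → 0 < z.2 → z ≠ (1,1) → 0 < D z := by
    intro z h1 h2 hz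
    have e1 := (s19_sgn p hp hp1 _ h1)
    have e2 := (s19_sgn q hq hq1 _ h2)
    have e3 : 0 ≤ B * C * ((z.1 - z.2)^2 / (z.1 * z.2)) := by positivity
    have e4 := mul_nonneg hC.le e1.1
    have e5 := mul_nonneg hB.le e2.1
    by_cases h : z.1 = 1
    · have h' : z.2 ≠ 1 := fun h' => hz (Prod.ext h h')
      have := mul_pos hB (e2.2 h')
      simp only [D]; linarith
    · have := mul_pos hC (e1.2 h)
      simp only [D]; linarith
  have hLp : ∀ z : ℝ × ℝ, 0 < z.1 → 0 < z.2 → z ≠ (1,1) → 0 < L z := by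
    intro z h1 h2 hz
    have e4 := mul_nonneg hC.le (s19_h_nonneg _ h1)
    have e5 := mul_nonneg hB.le (s19_h_nonneg _ h2)
    by_cases h : z.1 = 1
    · have h' : z.2 ≠ 1 := fun h' => hz (Prod.ext h h')
      have := mul_pos hB (s19_h_pos _ h2 h')
      simp only [L]; linarith
    · have := mul_pos hC (s19_h_pos _ h1 h)
      simp only [L]; linarith
  have hin : ∀ t ≥ (0:ℝ), (x t, y t) ∈ Ioo (δ/2) (2*(M+1)+1) ×ˢ Ioo (δ/2) (2*(M+1)+1) := by
    have hsub : Icc δ (2*(M+1)) ×ˢ Icc δ (2*(M+1)) ⊆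
        Ioo (δ/2) (2*(M+1)+1) ×ˢ Ioo (δ/2) (2*(M+1)+1) := by
      apply Set.prod_mono <;> exact fun s hs => ⟨by linarith [hs.1], by linarith [hs.2]⟩
    apply s19_trap _ (Icc δ (2*(M+1)) ×ˢ Icc δ (2*(M+1))) (isOpen_Ioo.prod isOpen_Ioo)
      (isClosed_Icc.prod isClosed_Icc) hsub (fun t => (x t, y t)) (hxc.prodMk hyc)
    · simp only [hx, hy]; exact hsub (sub _ hx0 hy0 le_rfl)
    · intro T hT hO
      have hTT := hO T ⟨hT, le_rfl⟩
      apply sub _ (lt_trans (by positivity) hTT.1.1) (lt_trans (by positivity) hTT.2.1)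
      have anti : AntitoneOn (fun s => L (x s, y s)) (Icc 0 T) := by
        apply antitoneOn_of_deriv_nonpos (convex_Icc 0 T)
        · exact HasDerivAt.continuousOn fun t ht => hd t ht.1 (hO t ht).1 (hO t ht).2
        · intro t ht
          have ht := interior_subset ht
          exact (hd t ht.1 (hO t ht).1 (hO t ht).2).differentiableAt.differentiableWithinAt
        · intro t ht
          have ht := interior_subset ht
          rw [(hd t ht.1 (hO t ht).1 (hO t ht).2).deriv]
          have := hDn (x t, y t) (lt_trans (by positivity) (hO t ht).1.1) (lt_trans (by positivity) (hO t ht).2.1)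
          linarith
      have := anti (left_mem_Icc.2 hT) (right_mem_Icc.2 hT) hT
      simpa only [hx, hy] using this
  have hpos : ∀ z ∈ Icc (δ/2) (2*(M+1)+1) ×ˢ Icc (δ/2) (2*(M+1)+1), 0 < z.1 ∧ 0 < z.2 :=
    fun z hz => ⟨lt_of_lt_of_le (by positivity) hz.1.1, lt_of_lt_of_le (by positivity) hz.2.1⟩
  have conv : Tendsto (fun t => (x t, y t)) atTop (𝓝 ((1:ℝ),(1:ℝ))) := by
    apply s19_conv (Icc (δ/2) (2*(M+1)+1) ×ˢ Icc (δ/2) (2*(M+1)+1))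
      (isCompact_Icc.prod isCompact_Icc) (1,1) L D
    · intro z hz
      obtain ⟨h1, h2⟩ := hpos z hz
      have : ContinuousAt L z := by
        simp only [L]
        have := h1.ne'
        have := h2.ne'
        fun_prop (disch := assumption)
      exact this.continuousWithinAt
    · have m1 : MapsTo Prod.fst (Icc (δ/2) (2*(M+1)+1) ×ˢ Icc (δ/2) (2*(M+1)+1)) (Ioi (0:ℝ)) :=
        fun z hz => (hpos z hz).1
      have m2 : MapsTo Prod.snd (Icc (δ/2) (2*(M+1)+1) ×ˢ Icc (δ/2) (2*(M+1)+1)) (Ioi (0:ℝ)) :=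
        fun z hz => (hpos z hz).2
      have c1 := hpc.comp continuousOn_fst m1
      have c2 := hqc.comp continuousOn_snd m2
      apply ContinuousOn.add
      · apply ContinuousOn.add
        · apply continuousOn_const.mul
          apply ContinuousOn.div (by fun_prop) (by fun_prop)
          intro z hz; exact (mul_pos (hpos z hz).1 (hpos z hz).2).ne'
        · exact continuousOn_const.mul (ContinuousOn.mul (by fun_prop) c1)
      · exact continuousOn_const.mul (ContinuousOn.mul (by fun_prop) c2)
    · simp [L]
    · intro z hz; exact hLp z (hpos z hz).1 (hpos z hz).2
    · intro z hz; exact hDp z (hpos z hz).1 (hpos z hz).2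
    · simp [D]
    · intro t ht
      exact ⟨Ioo_subset_Icc_self (hin t ht).1, Ioo_subset_Icc_self (hin t ht).2⟩
    · intro t ht; exact hd t ht (hin t ht).1 (hin t ht).2
  exact ⟨fun t ht => hin t ht, (continuous_fst.tendsto _).comp conv, (continuous_snd.tendsto _).comp conv⟩

lemma s19_small (F : ℝ → ℝ) (hF : ContDiffOn ℝ 2 F (Ici 0)) (h0 : F 0 = 0)
    (hd : derivWithin F (Ici 0) 0 = 0) (e : ℝ) (he : 0 < e) :
    ∃ η > 0, ∀ u, 0 < u → u < η → F u / u < e := by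
  have h1 : HasDerivWithinAt F 0 (Ici 0) 0 := by
    have h := ((hF.differentiableOn two_ne_zero) 0 self_mem_Ici).hasDerivWithinAt
    rwa [hd] at h
  rw [hasDerivWithinAt_iff_tendsto_slope] at h1
  have h2 := h1.eventually (gt_mem_nhds he)
  rw [Ici_sdiff_left, eventually_nhdsWithin_iff, Metric.eventually_nhds_iff] at h2
  obtain ⟨η, hη, h⟩ := h2
  refine ⟨η, hη, fun u hu hu2 => ?_⟩
  have := h (y := u) (by simpa [abs_of_pos hu] using hu2) hu
  simpa [slope_def_field, h0] using this

lemma s19_eq (a b c d : ℝ) (ha : 0 < a) (hb : 0 < b) (hc : 0 < c) (hd : 0 < d)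
    (hbcad : 0 < b * c - a * d) (F G : ℝ → ℝ) (hA : CondA F G) :
    ∃ ustar vstar : ℝ, IsEquilibrium a b c d F G ustar vstar ∧
      (∀ u' v' : ℝ, IsEquilibrium a b c d F G u' v' → u' = ustar ∧ v' = vstar) := by
  have Fn : ∀ u, 0 ≤ u → 0 ≤ F u := fun u hu => by
    have := hA.monoF self_mem_Ici (mem_Ici.2 hu) hu; rwa [hA.zeroF] at this
  have Gn : ∀ u, 0 ≤ u → 0 ≤ G u := fun u hu => by
    have := hA.monoG self_mem_Ici (mem_Ici.2 hu) hu; rwa [hA.zeroG] at this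
  let φ : ℝ → ℝ := fun u => (a * u + F u) / b
  let k : ℝ → ℝ := fun u => c * u - d * φ u - G (φ u)
  have φp : ∀ u, 0 < u → 0 < φ u := fun u hu => by
    have := Fn u hu.le
    simp only [φ]; positivity
  have φn : ∀ u, 0 ≤ u → 0 ≤ φ u := fun u hu => by
    have := Fn u hu
    simp only [φ]; positivity
  -- factorization
  have fac : ∀ u, 0 < u → k u * b = u * (b * c - (a + F u / u) * (d + G (φ u) / φ u)) := by
    intro u hu
    have h1 := φp u hu
    have h2 : (a + F u / u) * u = b * φ u := by simp only [φ]; field_simp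
    have h3 : (d + G (φ u) / φ u) * φ u = d * φ u + G (φ u) := by field_simp
    calc k u * b = b * c * u - b * (d * φ u + G (φ u)) := by simp only [k]; ring
      _ = b * c * u - (d + G (φ u) / φ u) * (b * φ u) := by rw [← h3]; ring
      _ = _ := by rw [← h2]; ring
  have kc : ContinuousOn k (Ici 0) := by
    have hφ : ContinuousOn φ (Ici 0) :=
      ((continuousOn_const.mul continuousOn_id).add hA.regF.continuousOn).div_const b
    have hG : ContinuousOn (fun u => G (φ u)) (Ici 0) :=
      hA.regG.continuousOn.comp hφ (fun u hu => φn u hu)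
    exact ((continuousOn_const.mul continuousOn_id).sub (continuousOn_const.mul hφ)).sub hG
  -- small u
  obtain ⟨u1, hu1, hk1⟩ : ∃ u, 0 < u ∧ 0 < k u := by
    obtain ⟨e, he, he2⟩ : ∃ e > 0, (a + e) * (d + e) < b * c := by
      have ht : Tendsto (fun e : ℝ => (a+e)*(d+e)) (𝓝[>] 0) (𝓝 ((a+0)*(d+0))) := by
        apply Tendsto.mono_left _ nhdsWithin_le_nhds
        exact Continuous.tendsto (by fun_prop) 0
      have h := ht.eventually (gt_mem_nhds (show (a+0)*(d+0) < b*c by simp; linarith))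
      obtain ⟨e, h1, h2⟩ := (h.and self_mem_nhdsWithin).exists
      exact ⟨e, h2, h1⟩
    obtain ⟨η1, hη1, hF⟩ := s19_small F hA.regF hA.zeroF hA.dzeroF e he
    obtain ⟨η2, hη2, hG⟩ := s19_small G hA.regG hA.zeroG hA.dzeroG e he
    have hs : 0 < η2 * b / (a + e) := by positivity
    set u := min η1 (η2 * b / (a + e)) / 2 with hu
    have hmp : 0 < min η1 (η2 * b / (a + e)) := lt_min hη1 hs
    have hup : 0 < u := by positivity
    have hul1 : u < η1 := by linarith [min_le_left η1 (η2 * b / (a + e))]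
    have hul2 : u < η2 * b / (a + e) := by linarith [min_le_right η1 (η2 * b / (a + e))]
    have f1 := hF u hup hul1
    have f2 : φ u < η2 := by
      simp only [φ]
      rw [div_lt_iff₀ hb]
      rw [lt_div_iff₀ (by positivity)] at hul2
      rw [div_lt_iff₀ hup] at f1
      linarith
    have f3 := hG _ (φp u hup) f2
    refine ⟨u, hup, ?_⟩
    have h4 := fac u hup
    have g1 : 0 ≤ F u / u := div_nonneg (Fn u hup.le) hup.le
    have h5 : (a + F u / u) * (d + G (φ u) / φ u) ≤ (a + e) * (d + e) := by
      have g2 : 0 ≤ G (φ u) / φ u := div_nonneg (Gn _ (φp u hup).le) (φp u hup).le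
      gcongr
    have h6 : 0 < k u * b := by rw [h4]; exact mul_pos hup (by linarith)
    exact pos_of_mul_pos_left h6 hb.le
  obtain ⟨u2, hu2, hk2⟩ : ∃ u, u1 < u ∧ k u < 0 := by
    obtain ⟨u, h1, h2⟩ := ((hA.infF.eventually_ge_atTop (b * c / d)).and (eventually_gt_atTop u1)).exists
    have hup := hu1.trans h2
    refine ⟨u, h2, ?_⟩
    have g2 : 0 ≤ G (φ u) / φ u := div_nonneg (Gn _ (φp u hup).le) (φp u hup).le
    have h5 : (a + b * c / d) * d ≤ (a + F u / u) * (d + G (φ u) / φ u) := by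
      have : 0 ≤ b * c / d := by positivity
      apply mul_le_mul <;> linarith
    have h7 : (a + b * c / d) * d = a * d + b * c := by field_simp
    have h6 : k u * b < 0 := by
      rw [fac u hup]; exact mul_neg_of_pos_of_neg hup (by nlinarith [mul_pos ha hd])
    by_contra hh
    push Not at hh
    linarith [mul_nonneg hh hb.le]
  obtain ⟨u, hu, hku⟩ := intermediate_value_Icc' hu2.le
    (kc.mono (fun x hx => le_trans hu1.le hx.1)) (show (0:ℝ) ∈ Icc (k u2) (k u1) from ⟨hk2.le, hk1.le⟩)
  have hup : 0 < u := hu1.trans_le hu.1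
  have toφ : ∀ u' v', IsEquilibrium a b c d F G u' v' → v' = φ u' ∧ k u' = 0 := by
    rintro u' v' ⟨h1, h2, h3, h4⟩
    have : v' = φ u' := by simp only [φ]; rw [eq_div_iff hb.ne']; linarith
    refine ⟨this, ?_⟩
    simp only [k]; rw [← this]; exact h4
  have uniq : ∀ u u', 0 < u → u < u' → k u = 0 → k u' ≠ 0 := by
    intro u u' h1 h2 h3 h4
    have hu' := h1.trans h2
    have e1 := fac u h1
    have e2 := fac u' hu'
    rw [h3, zero_mul] at e1
    rw [h4, zero_mul] at e2
    have e1' := (mul_eq_zero.1 e1.symm).resolve_left h1.ne'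
    have e2' := (mul_eq_zero.1 e2.symm).resolve_left hu'.ne'
    have m1 : F u / u < F u' / u' := hA.ratioF h1 hu' h2
    have m2 : φ u < φ u' := by
      have := hA.monoF (mem_Ici.2 h1.le) (mem_Ici.2 hu'.le) h2.le
      simp only [φ]
      apply div_lt_div_of_pos_right _ hb
      have := mul_lt_mul_of_pos_left h2 ha
      linarith
    have m3 : G (φ u) / φ u < G (φ u') / φ u' := hA.ratioG (φp u h1) (φp u' hu') m2
    have g1 : 0 ≤ F u / u := div_nonneg (Fn u h1.le) h1.le
    have g2 : 0 ≤ G (φ u) / φ u := div_nonneg (Gn _ (φp u h1).le) (φp u h1).le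
    have : (a + F u / u) * (d + G (φ u) / φ u) < (a + F u' / u') * (d + G (φ u') / φ u') := by
      apply mul_lt_mul'' <;> linarith
    linarith
  refine ⟨u, φ u, ⟨hup, φp u hup, ?_, hku⟩, ?_⟩
  · have : b * φ u = a * u + F u := by simp only [φ]; field_simp
    linarith
  · intro u' v' h
    obtain ⟨h1, h2⟩ := toφ u' v' h
    have : u' = u := by
      rcases lt_trichotomy u' u with h3 | h3 | h3
      · exact absurd hku (uniq _ _ h.1 h3 h2)
      · exact h3
      · exact absurd h2 (uniq _ _ hup h3 hku)
    exact ⟨this, by rw [h1, this]⟩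

lemma s19_ratio (F : ℝ → ℝ) (hF : ContDiffOn ℝ 2 F (Ici 0))
    (hr : StrictMonoOn (fun z => F z / z) (Ioi 0)) (u : ℝ) (hu : 0 < u) :
    StrictMonoOn (fun x => F (u * x) / (u * x) - F u / u) (Ioi 0) ∧
    ContDiffOn ℝ 1 (fun x => F (u * x) / (u * x) - F u / u) (Ioi 0) := by
  constructor
  · intro x hx y hy hxy
    have := hr (mul_pos hu hx) (mul_pos hu hy) (mul_lt_mul_of_pos_left hxy hu)
    simp only at this ⊢
    linarith
  · apply ContDiffOn.sub _ contDiffOn_const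
    apply ContDiffOn.div
    · exact (hF.of_le one_le_two).comp (by fun_prop) (fun x hx => (mul_pos hu hx).le)
    · fun_prop
    · intro x hx; exact (mul_pos hu hx).ne'

theorem statement19
    (d1 d2 a b c d : ℝ)
    (hd1 : 0 < d1) (hd2 : 0 < d2) (ha : 0 < a) (hb : 0 < b) (hc : 0 < c) (hd : 0 < d)
    (hbcad : 0 < b * c - a * d)
    (F G : ℝ → ℝ) (hA : CondA F G) :
    ∃ ustar vstar : ℝ, IsEquilibrium a b c d F G ustar vstar ∧
      (∀ u' v' : ℝ, IsEquilibrium a b c d F G u' v' → u' = ustar ∧ v' = vstar) ∧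
      (∀ U0 V0 : ℝ, 0 < U0 → 0 < V0 →
        ∃ U V : ℝ → ℝ, U 0 = U0 ∧ V 0 = V0 ∧
          (∀ t ≥ (0:ℝ),
            HasDerivAt U (-a * U t + b * V t - F (U t)) t ∧
            HasDerivAt V (c * U t - d * V t - G (V t)) t) ∧
          Tendsto U atTop (𝓝 ustar) ∧ Tendsto V atTop (𝓝 vstar)) ∧
      (∀ U V : ℝ → ℝ, 0 < U 0 → 0 < V 0 →
        (∀ t ≥ (0:ℝ),
          HasDerivAt U (-a * U t + b * V t - F (U t)) t ∧
          HasDerivAt V (c * U t - d * V t - G (V t)) t) →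
        Tendsto U atTop (𝓝 ustar) ∧ Tendsto V atTop (𝓝 vstar)) := by
  obtain ⟨us, vs, heq, huniq⟩ := s19_eq a b c d ha hb hc hd hbcad F G hA
  obtain ⟨hu, hv, e1, e2⟩ := id heq
  let p : ℝ → ℝ := fun x => F (us * x) / (us * x) - F us / us
  let q : ℝ → ℝ := fun x => G (vs * x) / (vs * x) - G vs / vs
  obtain ⟨hp, hpc⟩ := s19_ratio F hA.regF hA.ratioF us hu
  obtain ⟨hq, hqc⟩ := s19_ratio G hA.regG hA.ratioG vs hv
  have hB : 0 < b * vs / us := by positivity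
  have hC : 0 < c * us / vs := by positivity
  have key := fun x0 y0 h1 h2 => s19_dyn (b * vs / us) (c * us / vs) hB hC p q hp hq
    (by simp [p]) (by simp [q]) hpc.continuousOn hqc.continuousOn x0 y0 h1 h2
  have id1 : ∀ x y, 0 < x → (-a * (us * x) + b * (vs * y) - F (us * x))
      = us * (b * vs / us * (y - x) - p x * x) := by
    intro x y hx
    simp only [p]
    have : F us = b * vs - a * us := by linarith
    rw [this]
    field_simp
    ring
  have id2 : ∀ x y, 0 < y → (c * (us * x) - d * (vs * y) - G (vs * y))
      = vs * (c * us / vs * (x - y) - q y * y) := by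
    intro x y hx
    simp only [q]
    have : G vs = c * us - d * vs := by linarith
    rw [this]
    field_simp
    ring
  have conv : ∀ U V : ℝ → ℝ, 0 < U 0 → 0 < V 0 →
        (∀ t ≥ (0:ℝ),
          HasDerivAt U (-a * U t + b * V t - F (U t)) t ∧
          HasDerivAt V (c * U t - d * V t - G (V t)) t) →
        Tendsto U atTop (𝓝 us) ∧ Tendsto V atTop (𝓝 vs) := by
    intro U V hU hV hode
    obtain ⟨δ, R, hδ, hδR, h⟩ := key (U 0 / us) (V 0 / vs) (by positivity) (by positivity)
    have hUe : ∀ t, U t = us * (U t / us) := fun t => by field_simp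
    have hVe : ∀ t, V t = vs * (V t / vs) := fun t => by field_simp
    obtain ⟨-, h1, h2⟩ := h (fun t => U t / us) (fun t => V t / vs) rfl rfl
      ((HasDerivAt.continuousOn fun t ht => (hode t ht).1).div_const _)
      ((HasDerivAt.continuousOn fun t ht => (hode t ht).2).div_const _) (by
        intro t ht hx hy
        obtain ⟨o1, o2⟩ := hode t ht
        constructor
        · refine (o1.div_const us).congr_deriv ?_
          have := id1 (U t / us) (V t / vs) (hδ.trans hx.1)
          rw [← hUe, ← hVe] at this
          rw [this, mul_div_cancel_left₀ _ (ne_of_gt (by assumption))]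
        · refine (o2.div_const vs).congr_deriv ?_
          have := id2 (U t / us) (V t / vs) (hδ.trans hy.1)
          rw [← hUe, ← hVe] at this
          rw [this, mul_div_cancel_left₀ _ (ne_of_gt (by assumption))])
    have h1' := h1.const_mul us
    have h2' := h2.const_mul vs
    simp only [← hUe, mul_one] at h1'
    simp only [← hVe, mul_one] at h2'
    exact ⟨h1', h2'⟩
  refine ⟨us, vs, heq, huniq, ?_, conv⟩
  intro U0 V0 hU0 hV0
  obtain ⟨δ, R, hδ, hδR, h⟩ := key (U0 / us) (V0 / vs) (by positivity) (by positivity)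
  have hP : ContDiffOn ℝ 1 (fun z : ℝ × ℝ => (b * vs / us * (z.2 - z.1) - p z.1 * z.1,
      c * us / vs * (z.1 - z.2) - q z.2 * z.2)) (Icc δ R ×ˢ Icc δ R) := by
    have m1 : MapsTo Prod.fst (Icc δ R ×ˢ Icc δ R) (Ioi (0:ℝ)) :=
      fun z hz => hδ.trans_le hz.1.1
    have m2 : MapsTo Prod.snd (Icc δ R ×ˢ Icc δ R) (Ioi (0:ℝ)) :=
      fun z hz => hδ.trans_le hz.2.1
    have c1 : ContDiffOn ℝ 1 (fun z : ℝ × ℝ => p z.1) (Icc δ R ×ˢ Icc δ R) :=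
      hpc.comp contDiffOn_fst m1
    have c2 : ContDiffOn ℝ 1 (fun z : ℝ × ℝ => q z.2) (Icc δ R ×ˢ Icc δ R) :=
      hqc.comp contDiffOn_snd m2
    apply ContDiffOn.prodMk
    · exact ContDiffOn.sub (by fun_prop) (c1.mul contDiffOn_fst)
    · exact ContDiffOn.sub (by fun_prop) (c2.mul contDiffOn_snd)
  obtain ⟨γ, g0, gc, gd⟩ := s19_box _ δ R hδR.le hP (U0 / us, V0 / vs)
  obtain ⟨hin, -, -⟩ := h (fun t => (γ t).1) (fun t => (γ t).2) (by simp [g0]) (by simp [g0])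
    (by fun_prop) (by fun_prop) (by
      intro t ht hx hy
      have := gd t ⟨Ioo_subset_Icc_self hx, Ioo_subset_Icc_self hy⟩
      exact ⟨this.fst, this.snd⟩)
  have hode : ∀ t ≥ (0:ℝ),
      HasDerivAt (fun t => us * (γ t).1)
        (-a * (us * (γ t).1) + b * (vs * (γ t).2) - F (us * (γ t).1)) t ∧
      HasDerivAt (fun t => vs * (γ t).2)
        (c * (us * (γ t).1) - d * (vs * (γ t).2) - G (vs * (γ t).2)) t := by
    intro t ht
    obtain ⟨hx, hy⟩ := hin t ht
    have := gd t ⟨Ioo_subset_Icc_self hx, Ioo_subset_Icc_self hy⟩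
    rw [id1 _ _ (hδ.trans hx.1), id2 _ _ (hδ.trans hy.1)]
    have j1 : HasDerivAt (fun t => (γ t).1)
      (b * vs / us * ((γ t).2 - (γ t).1) - p (γ t).1 * (γ t).1) t := this.fst
    have j2 : HasDerivAt (fun t => (γ t).2)
      (c * us / vs * ((γ t).1 - (γ t).2) - q (γ t).2 * (γ t).2) t := this.snd
    exact ⟨j1.const_mul us, j2.const_mul vs⟩
  have i1 : us * (γ 0).1 = U0 := by rw [g0]; field_simp
  have i2 : vs * (γ 0).2 = V0 := by rw [g0]; field_simp
  refine ⟨fun t => us * (γ t).1, fun t => vs * (γ t).2, i1, i2, hode, ?_⟩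
  exact conv _ _ (by simp only [i1]; exact hU0) (by simp only [i2]; exact hV0) hode

end
end
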